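/- There exist absolute constants a, c > 0 such that the following holds. Let n, m, k, ℓ be positive integers with 2 ≤ k, let δ ∈ (0, 1/2), and suppose 2k ≤ ℓ ≤ n/8 and m ≥ (2^{a·k}/δ⁴) · (n/ℓ)^{k/2 − 1} · n log n. Let H be a multiset of m tuples sampled independently and uniformly at random from [n]^k, and let {σ_C}_{C∈H} be independent Rademacher random variables (uniform on {−1,1}). Then with probability at least 1 − n^{−c} over the draw of H and of the σ_C's, every pseudo-expectation Ẽ of degree at least 2ℓ over {−1,1}^n satisfies |Ẽ[ (1/m) Σ_{C∈H} σ_C x_C ]| ≤ δ + 2k²/n. -/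

import Mathlib

open MvPolynomial Finset

/-- A degree-`d` pseudo-expectation over the hypercube `{−1,1}ⁿ`. -/
structure PseudoExpectation (n d : ℕ) where
  toFun : MvPolynomial (Fin n) ℝ →ₗ[ℝ] ℝ
  normalized : toFun 1 = 1
  boolean : ∀ (i : Fin n) (f : MvPolynomial (Fin n) ℝ),
      f.totalDegree + 2 ≤ d → toFun (X i ^ 2 * f) = toFun f
  posSq : ∀ f : MvPolynomial (Fin n) ℝ, 2 * f.totalDegree ≤ d → 0 ≤ toFun (f ^ 2)

/-- Power trick: trace bound for a symmetric matrix against a PSD matrix with unit diagonal. -/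
theorem hx_cs {X : Type*} [Fintype X] [DecidableEq X] (M A : Matrix X X ℝ) (hM : M.PosSemidef)
    (hd : ∀ x, M x x = 1) (hA : A.transpose = A) :
    (A * M).trace ^ 2 ≤ (Fintype.card X : ℝ) * (A ^ 2 * M).trace := by
  have htr : M.trace = (Fintype.card X : ℝ) := by simp [Matrix.trace, hd]
  have key : ∀ z : ℝ, 0 ≤ (Fintype.card X : ℝ) * (z * z) + (2 * (A * M).trace) * z
      + (A ^ 2 * M).trace := by
    intro z
    have h1 := (hM.mul_mul_conjTranspose_same (z • (1 : Matrix X X ℝ) + A)).trace_nonneg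
    have h2 : ((z • (1 : Matrix X X ℝ) + A) * M * (z • (1 : Matrix X X ℝ) + A).conjTranspose).trace
        = (Fintype.card X : ℝ) * (z * z) + (2 * (A * M).trace) * z + (A ^ 2 * M).trace := by
      rw [Matrix.conjTranspose_eq_transpose_of_trivial, Matrix.transpose_add, hA,
        Matrix.transpose_smul, Matrix.transpose_one]
      have e1 : (A * M * A).trace = (A ^ 2 * M).trace := by
        rw [Matrix.trace_mul_comm, ← mul_assoc, pow_two]
      have e2 : (M * A).trace = (A * M).trace := Matrix.trace_mul_comm _ _
      simp only [add_mul, mul_add, Matrix.trace_add, Matrix.smul_mul, Matrix.mul_smul, one_mul,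
        mul_one, Matrix.trace_smul, e1, e2, htr, smul_eq_mul]
      ring
    rwa [h2] at h1
  have := discrim_le_zero key
  unfold discrim at this
  nlinarith

theorem hx_entry {X : Type*} [Fintype X] [DecidableEq X] (M : Matrix X X ℝ) (hM : M.PosSemidef)
    (hd : ∀ x, M x x = 1) (x y : X) : |M x y| ≤ 1 := by
  have hs : M y x = M x y := by
    have := hM.isHermitian.apply x y
    simpa using this
  by_cases hxy : x = y
  · subst hxy; simp [hd]
  have q : ∀ c : ℝ, 0 ≤ 1 + 2 * c * M x y + c * c := by
    intro c
    have h := hM.dotProduct_mulVec_nonneg (Pi.single x 1 + Pi.single y c)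
    have : (star (Pi.single x 1 + Pi.single y c) ⬝ᵥ M.mulVec (Pi.single x 1 + Pi.single y c))
      = 1 + 2 * c * M x y + c * c := by
      simp [Matrix.mulVec_add, add_dotProduct, dotProduct_add, hd, hs]
      ring
    rwa [this] at h
  have h1 := q 1
  have h2 := q (-1)
  rw [abs_le]; constructor <;> linarith

theorem hx_trsq {X : Type*} [Fintype X] [DecidableEq X] (B : Matrix X X ℝ)
    (hB : B.transpose = B) : (B ^ 2).trace = ∑ x, ∑ y, (B x y) ^ 2 := by
  simp only [Matrix.trace, Matrix.diag, pow_two, Matrix.mul_apply]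
  refine Finset.sum_congr rfl fun x _ => Finset.sum_congr rfl fun y _ => ?_
  have : B y x = B x y := congrFun (congrFun hB x) y
  rw [this]

theorem hx_base {X : Type*} [Fintype X] [DecidableEq X] (M B : Matrix X X ℝ) (hM : M.PosSemidef)
    (hd : ∀ x, M x x = 1) (hB : B.transpose = B) :
    (B ^ 2 * M).trace ≤ (Fintype.card X : ℝ) * (B ^ 2).trace := by
  have e1 : (B ^ 2 * M).trace = (B * M * B).trace := by
    rw [Matrix.trace_mul_comm (B * M), ← mul_assoc, pow_two]
  have hsym : ∀ x y, B y x = B x y := fun x y => congrFun (congrFun hB x) y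
  rw [e1, hx_trsq B hB, Finset.mul_sum]
  simp only [Matrix.trace, Matrix.diag]
  refine Finset.sum_le_sum fun z _ => ?_
  rw [Matrix.mul_apply]
  calc ∑ j, (B * M) z j * B j z = ∑ j, ∑ i, B z i * M i j * B z j := by
        refine Finset.sum_congr rfl fun j _ => ?_
        rw [Matrix.mul_apply, Finset.sum_mul, hsym]
    _ ≤ ∑ j, ∑ i, (B z i ^ 2 / 2 + B z j ^ 2 / 2) := by
        refine Finset.sum_le_sum fun j _ => Finset.sum_le_sum fun i _ => ?_
        have h := hx_entry M hM hd i j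
        calc B z i * M i j * B z j ≤ |B z i * M i j * B z j| := le_abs_self _
          _ = |B z i| * |B z j| * |M i j| := by rw [abs_mul, abs_mul]; ring
          _ ≤ |B z i| * |B z j| * 1 := by gcongr
          _ ≤ _ := by
            have := sq_nonneg (|B z i| - |B z j|)
            nlinarith [sq_abs (B z i), sq_abs (B z j)]
    _ = _ := by
        simp only [Finset.sum_add_distrib, Finset.sum_const, Finset.card_univ, nsmul_eq_mul]
        rw [← Finset.mul_sum, ← Finset.sum_div]; ring

theorem hx_power {X : Type*} [Fintype X] [DecidableEq X] (M A : Matrix X X ℝ) (hM : M.PosSemidef)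
    (hd : ∀ x, M x x = 1) (hA : A.transpose = A) (q : ℕ) :
    (A * M).trace ^ (2 ^ (q + 1)) ≤ (Fintype.card X : ℝ) ^ (2 ^ (q + 1)) *
      (A ^ (2 ^ (q + 1))).trace := by
  have hN : (0 : ℝ) ≤ Fintype.card X := by positivity
  induction q generalizing A with
  | zero =>
    calc (A * M).trace ^ (2 ^ (0 + 1)) = (A * M).trace ^ 2 := by norm_num
      _ ≤ _ := hx_cs M A hM hd hA
      _ ≤ (Fintype.card X : ℝ) * ((Fintype.card X : ℝ) * (A ^ 2).trace) :=
        mul_le_mul_of_nonneg_left (hx_base M A hM hd hA) hN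
      _ = _ := by norm_num; ring
  | succ q ih =>
    have hA2 : (A ^ 2).transpose = A ^ 2 := by rw [Matrix.transpose_pow, hA]
    have h1 := ih (A ^ 2) hA2
    have h2 := hx_cs M A hM hd hA
    have e : 2 ^ (q + 1 + 1) = 2 * 2 ^ (q + 1) := by ring
    rw [e, pow_mul, pow_mul A]
    calc ((A * M).trace ^ 2) ^ 2 ^ (q + 1)
        ≤ ((Fintype.card X : ℝ) * (A ^ 2 * M).trace) ^ 2 ^ (q + 1) :=
          pow_le_pow_left₀ (sq_nonneg _) h2 _
      _ = (Fintype.card X : ℝ) ^ 2 ^ (q + 1) * (A ^ 2 * M).trace ^ 2 ^ (q + 1) := mul_pow _ _ _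
      _ ≤ (Fintype.card X : ℝ) ^ 2 ^ (q + 1) * ((Fintype.card X : ℝ) ^ (2 ^ (q + 1)) *
      ((A ^ 2) ^ (2 ^ (q + 1))).trace) := by gcongr
      _ = _ := by rw [two_mul (2 ^ (q + 1)), pow_add]; ring

/-- Real-valued indicator. -/
noncomputable def hxInd (p : Prop) : ℝ := by classical exact if p then 1 else 0

theorem hxInd_nonneg (p : Prop) : 0 ≤ hxInd p := by unfold hxInd; split_ifs <;> norm_num
theorem hxInd_le_one (p : Prop) : hxInd p ≤ 1 := by unfold hxInd; split_ifs <;> norm_num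
theorem hxInd_true {p : Prop} (h : p) : hxInd p = 1 := by unfold hxInd; simp [h]
theorem hxInd_false {p : Prop} (h : ¬ p) : hxInd p = 0 := by unfold hxInd; simp [h]
theorem hxInd_mono {p q : Prop} (h : p → q) : hxInd p ≤ hxInd q := by
  by_cases hp : p
  · rw [hxInd_true hp, hxInd_true (h hp)]
  · rw [hxInd_false hp]; exact hxInd_nonneg q
theorem hxInd_and (p q : Prop) : hxInd (p ∧ q) = hxInd p * hxInd q := by
  by_cases hp : p <;> by_cases hq : q <;> simp [hxInd, hp, hq]
theorem hxInd_congr {p q : Prop} (h : p ↔ q) : hxInd p = hxInd q := by rw [propext h]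

theorem hx_sum_ind {ι : Type*} (s : Finset ι) (p : ι → Prop) [DecidablePred p] :
    ∑ i ∈ s, hxInd (p i) = ((s.filter p).card : ℝ) := by
  rw [Finset.card_filter]; push_cast
  refine Finset.sum_congr rfl fun i _ => ?_
  unfold hxInd; split_ifs <;> rfl

/-- Resampling one coordinate. -/
theorem hx_resample {m : ℕ} {β : Type*} [Fintype β] (l : Fin m) (G : (Fin m → β) → ℝ) :
    ∑ H : Fin m → β, ∑ a : β, G (Function.update H l a) = (Fintype.card β : ℝ) * ∑ H, G H := by
  classical
  let e : ((Fin m → β) × β) ≃ ((Fin m → β) × β) :=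
    { toFun := fun p => (Function.update p.1 l p.2, p.1 l)
      invFun := fun p => (Function.update p.1 l p.2, p.1 l)
      left_inv := fun p => by simp
      right_inv := fun p => by simp }
  have h := Equiv.sum_comp e (fun p => G p.1)
  rw [Fintype.sum_prod_type, Fintype.sum_prod_type] at h
  simp only [e, Equiv.coe_fn_mk, Finset.sum_const, Finset.card_univ, nsmul_eq_mul] at h
  rw [h, Finset.mul_sum]

theorem hx_indep {m : ℕ} {β : Type*} [Fintype β] [Nonempty β] (l : Fin m)
    (V : (Fin m → β) → ℝ) (f : (Fin m → β) → β → ℝ) (c : ℝ)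
    (hV0 : ∀ H, 0 ≤ V H)
    (hV : ∀ H a, V (Function.update H l a) = V H)
    (hf : ∀ H a b, f (Function.update H l b) a = f H a)
    (hc : ∀ H, ∑ a, f H a ≤ c * (Fintype.card β : ℝ)) :
    ∑ H, V H * f H (H l) ≤ c * ∑ H, V H := by
  have hb : (0 : ℝ) < Fintype.card β := by exact_mod_cast Fintype.card_pos
  have h := hx_resample l (fun H => V H * f H (H l))
  simp only [hV, hf, Function.update_self] at h
  have : (Fintype.card β : ℝ) * ∑ H, V H * f H (H l) ≤ (Fintype.card β : ℝ) * (c * ∑ H, V H) := by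
    rw [← h, Finset.mul_sum, Finset.mul_sum]
    refine Finset.sum_le_sum fun H _ => ?_
    rw [← Finset.mul_sum]
    have := mul_le_mul_of_nonneg_left (hc H) (hV0 H)
    linarith
  exact le_of_mul_le_mul_left this hb

theorem hx_indep_prod {m : ℕ} {β : Type*} [Fintype β] [Nonempty β] (I : Finset (Fin m))
    (V : (Fin m → β) → ℝ) (D : β → Prop) (c : ℝ) (hc0 : 0 ≤ c)
    (hV0 : ∀ H, 0 ≤ V H)
    (hV : ∀ l ∈ I, ∀ H a, V (Function.update H l a) = V H)
    (hc : ∑ a, hxInd (D a) ≤ c * (Fintype.card β : ℝ)) :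
    ∑ H, V H * ∏ l ∈ I, hxInd (D (H l)) ≤ c ^ I.card * ∑ H, V H := by
  classical
  induction I using Finset.induction_on with
  | empty => simp
  | insert l I hl ih =>
    have h1 := ih (fun l' hl' => hV l' (Finset.mem_insert_of_mem hl'))
    have h2 := hx_indep l (fun H => V H * ∏ l ∈ I, hxInd (D (H l))) (fun _ a => hxInd (D a)) c
      (fun H => mul_nonneg (hV0 H) (Finset.prod_nonneg fun _ _ => hxInd_nonneg _))
      (fun H a => by
        rw [hV l (Finset.mem_insert_self _ _)]
        congr 1
        refine Finset.prod_congr rfl fun j hj => ?_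
        rw [Function.update_of_ne]; rintro rfl; exact hl hj)
      (fun _ _ _ => rfl) (fun _ => hc)
    rw [Finset.card_insert_of_notMem hl]
    calc ∑ H, V H * ∏ l ∈ insert l I, hxInd (D (H l))
        = ∑ H, V H * (∏ l ∈ I, hxInd (D (H l))) * hxInd (D (H l)) := by
          refine Finset.sum_congr rfl fun H _ => ?_
          rw [Finset.prod_insert hl]; ring
      _ ≤ c * ∑ H, V H * ∏ l ∈ I, hxInd (D (H l)) := h2
      _ ≤ c * (c ^ I.card * ∑ H, V H) := by gcongr
      _ = _ := by ring

/-- Binomial upper tail, with an independent weight. -/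
theorem hx_tail {m : ℕ} {β : Type*} [Fintype β] [Nonempty β] (U : Finset (Fin m))
    (V : (Fin m → β) → ℝ) (D : β → Prop) (c : ℝ) (hc0 : 0 ≤ c)
    (hV0 : ∀ H, 0 ≤ V H)
    (hV : ∀ l ∈ U, ∀ H a, V (Function.update H l a) = V H)
    (hc : ∑ a, hxInd (D a) ≤ c * (Fintype.card β : ℝ)) (q : ℕ) :
    ∑ H, V H * hxInd (∃ I ⊆ U, I.card = q ∧ ∀ l ∈ I, D (H l)) ≤
      (((m : ℝ) * c) ^ q / (q.factorial : ℝ)) * ∑ H, V H := by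
  classical
  have hS : 0 ≤ ∑ H, V H := Finset.sum_nonneg fun H _ => hV0 H
  calc ∑ H, V H * hxInd (∃ I ⊆ U, I.card = q ∧ ∀ l ∈ I, D (H l))
      ≤ ∑ H, V H * ∑ I ∈ U.powersetCard q, ∏ l ∈ I, hxInd (D (H l)) := by
        refine Finset.sum_le_sum fun H _ => mul_le_mul_of_nonneg_left ?_ (hV0 H)
        have hnn : ∀ I ∈ U.powersetCard q, 0 ≤ ∏ l ∈ I, hxInd (D (H l)) :=
          fun I _ => Finset.prod_nonneg fun _ _ => hxInd_nonneg _
        by_cases h : ∃ I ⊆ U, I.card = q ∧ ∀ l ∈ I, D (H l)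
        · rw [hxInd_true h]
          obtain ⟨I, hI, hq, hD⟩ := h
          have : (1 : ℝ) = ∏ l ∈ I, hxInd (D (H l)) := by
            rw [Finset.prod_eq_one]; intro l hl; exact hxInd_true (hD l hl)
          rw [this]
          exact Finset.single_le_sum hnn (Finset.mem_powersetCard.2 ⟨hI, hq⟩)
        · rw [hxInd_false h]; exact Finset.sum_nonneg hnn
    _ = ∑ I ∈ U.powersetCard q, ∑ H, V H * ∏ l ∈ I, hxInd (D (H l)) := by
        simp only [Finset.mul_sum]; rw [Finset.sum_comm]
    _ ≤ ∑ I ∈ U.powersetCard q, c ^ q * ∑ H, V H := by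
        refine Finset.sum_le_sum fun I hI => ?_
        obtain ⟨h1, h2⟩ := Finset.mem_powersetCard.1 hI
        have := hx_indep_prod I V D c hc0 hV0 (fun l hl => hV l (h1 hl)) hc
        rwa [h2] at this
    _ = (U.card.choose q : ℝ) * (c ^ q * ∑ H, V H) := by
        rw [Finset.sum_const, Finset.card_powersetCard, nsmul_eq_mul]
    _ ≤ ((m : ℝ) ^ q / q.factorial) * (c ^ q * ∑ H, V H) := by
        gcongr
        calc (U.card.choose q : ℝ) ≤ (m.choose q : ℝ) := by
              exact_mod_cast Nat.choose_le_choose q (by simpa using Finset.card_le_univ U)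
          _ ≤ _ := Nat.choose_le_pow_div q m
    _ = _ := by rw [mul_pow]; ring

/-- Iterated sum over sequences of length `p`. -/
noncomputable def hxSum {σ : Type} [Fintype σ] : ℕ → (List σ → ℝ) → ℝ
  | 0, F => F []
  | p + 1, F => ∑ e : σ, hxSum p (fun s => F (e :: s))

theorem hxSum_le {σ : Type} [Fintype σ] (p : ℕ) (F G : List σ → ℝ)
    (h : ∀ s, s.length = p → F s ≤ G s) : hxSum p F ≤ hxSum p G := by
  induction p generalizing F G with
  | zero => exact h [] rfl
  | succ p ih =>
    exact Finset.sum_le_sum fun e _ => ih _ _ fun s hs => h _ (by simp [hs])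

theorem hxSum_sum {σ : Type} [Fintype σ] {ι : Type*} (p : ℕ) (S : Finset ι)
    (F : ι → List σ → ℝ) : hxSum p (fun s => ∑ i ∈ S, F i s) = ∑ i ∈ S, hxSum p (F i) := by
  induction p generalizing F with
  | zero => rfl
  | succ p ih =>
    simp only [hxSum]
    rw [Finset.sum_comm]
    exact Finset.sum_congr rfl fun e _ => ih _

theorem hxSum_mul {σ : Type} [Fintype σ] (p : ℕ) (c : ℝ) (F : List σ → ℝ) :
    hxSum p (fun s => c * F s) = c * hxSum p F := by
  induction p generalizing F with
  | zero => rfl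
  | succ p ih =>
    simp only [hxSum, Finset.mul_sum]
    exact Finset.sum_congr rfl fun e _ => ih _

theorem hxSum_succ {σ : Type} [Fintype σ] (p : ℕ) (F : List σ → ℝ) :
    hxSum (p + 1) F = hxSum p (fun s => ∑ e, F (e :: s)) := by
  rw [hxSum_sum]; rfl

/-- The flattened list of indices of a sequence of pairs. -/
def hxFlat {m : ℕ} : List (Fin m × Fin m) → List (Fin m)
  | [] => []
  | e :: s => e.1 :: e.2 :: hxFlat s

theorem hxFlat_length {m : ℕ} (s : List (Fin m × Fin m)) : (hxFlat s).length = 2 * s.length := by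
  induction s with
  | nil => rfl
  | cons e s ih => simp [hxFlat, ih]; ring

/-- Rademacher sign. -/
def hxSg (b : Bool) : ℝ := if b then 1 else -1

theorem hxSg_abs (b : Bool) : |hxSg b| = 1 := by cases b <;> simp [hxSg]
theorem hxSg_sq (b : Bool) : hxSg b * hxSg b = 1 := by cases b <;> simp [hxSg]
theorem hxSg_not (b : Bool) : hxSg (!b) = - hxSg b := by cases b <;> simp [hxSg]

theorem hx_prod_flip {m : ℕ} (w : List (Fin m)) (i : Fin m) (τ : Fin m → Bool) :
    (w.map fun j => hxSg (Function.update τ i (!(τ i)) j)).prod =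
      (-1) ^ (w.count i) * (w.map fun j => hxSg (τ j)).prod := by
  induction w with
  | nil => simp
  | cons a w ih =>
    simp only [List.map_cons, List.prod_cons, ih, List.count_cons]
    by_cases h : a = i
    · subst h; simp [hxSg_not, pow_succ]; ring
    · simp [h]; ring

theorem hx_sign_sum {m : ℕ} (w : List (Fin m)) :
    ∑ τ : Fin m → Bool, (w.map fun j => hxSg (τ j)).prod ≤
      2 ^ m * hxInd (2 * w.toFinset.card ≤ w.length) := by
  by_cases h : ∀ i ∈ w, Even (w.count i)
  · have h1 : 2 * w.toFinset.card ≤ w.length := by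
      rw [← List.sum_toFinset_count_eq_length w, mul_comm, ← smul_eq_mul, ← Finset.sum_const]
      refine Finset.sum_le_sum fun i hi => ?_
      have hi' := List.mem_toFinset.1 hi
      have := h i hi'
      have h2 := List.count_pos_iff.2 hi'
      obtain ⟨r, hr⟩ := this
      omega
    rw [hxInd_true h1]
    have : ∀ τ : Fin m → Bool, (w.map fun j => hxSg (τ j)).prod ≤ 1 := by
      intro τ
      have : |(w.map fun j => hxSg (τ j)).prod| = 1 := by
        clear h h1
        induction w with
        | nil => simp
        | cons a w ih => simp [abs_mul, hxSg_abs, ih]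
      exact this ▸ le_abs_self _
    calc _ ≤ ∑ τ : Fin m → Bool, (1 : ℝ) := Finset.sum_le_sum fun τ _ => this τ
      _ = _ := by simp
  · push Not at h
    obtain ⟨i, _, hi⟩ := h
    have hodd : (-1 : ℝ) ^ (w.count i) = -1 := Odd.neg_one_pow (Nat.not_even_iff_odd.1 hi)
    let e : (Fin m → Bool) ≃ (Fin m → Bool) :=
      { toFun := fun τ => Function.update τ i (!(τ i))
        invFun := fun τ => Function.update τ i (!(τ i))
        left_inv := fun τ => by simp
        right_inv := fun τ => by simp }
    have hh := Equiv.sum_comp e (fun τ => (w.map fun j => hxSg (τ j)).prod)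
    simp only [e, Equiv.coe_fn_mk, hx_prod_flip, hodd] at hh
    rw [← Finset.mul_sum] at hh
    have h0 : ∑ τ : Fin m → Bool, (w.map fun j => hxSg (τ j)).prod = 0 := by linarith
    rw [h0]
    exact mul_nonneg (by positivity) (hxInd_nonneg _)

/-- Abstract Kikuchi-type system of transitions. -/
structure HxSys (β κ X : Type) where
  key : β → κ
  e1 : β → X → Prop
  e2 : β → X → Prop
  step : β → β → X → X → Prop

/-- Goodness of a vertex with respect to a set of indices. -/
def HxSys.good {β κ X : Type} (Y : HxSys β κ X) {m : ℕ} (t : ℕ) (H : Fin m → β)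
    (U : Finset (Fin m)) (x : X) : Prop :=
  ∀ v : κ, ∑ j ∈ U, hxInd (Y.key (H j) = v ∧ Y.e2 (H j) x) ≤ (t : ℝ)

theorem HxSys.good_mono {β κ X : Type} (Y : HxSys β κ X) {m : ℕ} {t : ℕ} {H : Fin m → β}
    {U U' : Finset (Fin m)} (h : U ⊆ U') {x : X} (hg : Y.good t H U' x) : Y.good t H U x :=
  fun v => (Finset.sum_le_sum_of_subset_of_nonneg h fun _ _ _ => hxInd_nonneg _).trans (hg v)

theorem HxSys.good_congr {β κ X : Type} (Y : HxSys β κ X) {m : ℕ} {t : ℕ} {H H' : Fin m → β}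
    {U : Finset (Fin m)} (h : ∀ j ∈ U, H j = H' j) {x : X} :
    Y.good t H U x ↔ Y.good t H' U x := by
  unfold HxSys.good
  refine forall_congr' fun v => ?_
  rw [Finset.sum_congr rfl (g := fun j => hxInd (Y.key (H' j) = v ∧ Y.e2 (H' j) x))]
  intro j hj; rw [h j hj]

/-- Unsigned entry of one transition in the pruned graph. -/
noncomputable def HxSys.c {β κ X : Type} (Y : HxSys β κ X) {m : ℕ} (t : ℕ) (H : Fin m → β)
    (e : Fin m × Fin m) (y y' : X) : ℝ :=
  hxInd ((e.1 ≠ e.2 ∧ Y.key (H e.1) = Y.key (H e.2) ∧ Y.step (H e.1) (H e.2) y y') ∧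
    Y.good t H univ y ∧ Y.good t H univ y')

noncomputable def HxSys.c' {β κ X : Type} (Y : HxSys β κ X) {m : ℕ} (t : ℕ) (H : Fin m → β)
    (U : Finset (Fin m)) (e : Fin m × Fin m) (y y' : X) : ℝ :=
  hxInd ((e.1 ≠ e.2 ∧ Y.key (H e.1) = Y.key (H e.2) ∧ Y.step (H e.1) (H e.2) y y') ∧
    Y.good t H U y)

/-- Number of walks following a given sequence. -/
noncomputable def HxSys.B {β κ X : Type} [Fintype X] (Y : HxSys β κ X) {m : ℕ} (t : ℕ)
    (H : Fin m → β) : List (Fin m × Fin m) → X → X → ℝ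
  | [], x, y => hxInd (x = y)
  | e :: s, x, y' => ∑ y, Y.B t H s x y * Y.c t H e y y'

noncomputable def HxSys.V {β κ X : Type} [Fintype X] (Y : HxSys β κ X) {m : ℕ} (t : ℕ)
    (H : Fin m → β) : List (Fin m × Fin m) → X → X → ℝ
  | [], x, y => hxInd (x = y)
  | e :: s, x, y' => ∑ y, Y.V t H s x y * Y.c' t H (hxFlat s).toFinset e y y'

section
variable {β κ X : Type} [Fintype X] (Y : HxSys β κ X) {m : ℕ} (t : ℕ)

theorem HxSys.B_nonneg (H : Fin m → β) (s : List (Fin m × Fin m)) (x y : X) :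
    0 ≤ Y.B t H s x y := by
  induction s generalizing y with
  | nil => exact hxInd_nonneg _
  | cons e s ih => exact Finset.sum_nonneg fun z _ => mul_nonneg (ih z) (hxInd_nonneg _)

theorem HxSys.V_nonneg (H : Fin m → β) (s : List (Fin m × Fin m)) (x y : X) :
    0 ≤ Y.V t H s x y := by
  induction s generalizing y with
  | nil => exact hxInd_nonneg _
  | cons e s ih => exact Finset.sum_nonneg fun z _ => mul_nonneg (ih z) (hxInd_nonneg _)

theorem HxSys.B_le_V (H : Fin m → β) (s : List (Fin m × Fin m)) (x y : X) :
    Y.B t H s x y ≤ Y.V t H s x y := by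
  induction s generalizing y with
  | nil => exact le_rfl
  | cons e s ih =>
    refine Finset.sum_le_sum fun z _ => mul_le_mul (ih z) ?_ (hxInd_nonneg _)
      (Y.V_nonneg t H s x z)
    exact hxInd_mono fun h => ⟨h.1, Y.good_mono (Finset.subset_univ _) h.2.1⟩

theorem HxSys.V_congr {H H' : Fin m → β} (s : List (Fin m × Fin m))
    (h : ∀ j ∈ hxFlat s, H j = H' j) (x y : X) : Y.V t H s x y = Y.V t H' s x y := by
  induction s generalizing y with
  | nil => rfl
  | cons e s ih =>
    simp only [hxFlat, List.mem_cons] at h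
    have h1 := h e.1 (Or.inl rfl)
    have h2 := h e.2 (Or.inr (Or.inl rfl))
    have h3 : ∀ j ∈ hxFlat s, H j = H' j := fun j hj => h j (Or.inr (Or.inr hj))
    refine Finset.sum_congr rfl fun z _ => ?_
    rw [ih h3]
    congr 1
    unfold HxSys.c'
    rw [h1, h2]
    refine hxInd_congr (and_congr Iff.rfl (Y.good_congr fun j hj => h3 j (List.mem_toFinset.1 hj)))

/-- The signed pruned matrix. -/
noncomputable def HxSys.A (H : Fin m → β) (τ : Fin m → Bool) : Matrix X X ℝ :=
  fun x y => ∑ e : Fin m × Fin m, (hxSg (τ e.1) * hxSg (τ e.2)) * Y.c t H e x y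

theorem HxSys.A_pow [DecidableEq X] (H : Fin m → β) (τ : Fin m → Bool) (p : ℕ) (x y : X) :
    (Y.A t H τ ^ p) x y =
      hxSum p (fun s => ((hxFlat s).map fun j => hxSg (τ j)).prod * Y.B t H s x y) := by
  induction p generalizing y with
  | zero =>
    simp only [pow_zero, hxSum, hxFlat, HxSys.B, Matrix.one_apply, hxInd]
    simp
  | succ p ih =>
    rw [pow_succ, Matrix.mul_apply, hxSum_succ]
    simp only [ih, HxSys.A]
    have : ∀ s : List (Fin m × Fin m),
        (∑ e : Fin m × Fin m, ((hxFlat (e :: s)).map fun j => hxSg (τ j)).prod *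
          Y.B t H (e :: s) x y) = ∑ z, (∑ e : Fin m × Fin m, (hxSg (τ e.1) * hxSg (τ e.2)) *
            Y.c t H e z y) * (((hxFlat s).map fun j => hxSg (τ j)).prod * Y.B t H s x z) := by
      intro s
      simp only [HxSys.B, hxFlat, List.map_cons, List.prod_cons, Finset.mul_sum, Finset.sum_mul]
      rw [Finset.sum_comm]
      refine Finset.sum_congr rfl fun z _ => Finset.sum_congr rfl fun e _ => ?_
      ring
    simp only [this]
    rw [hxSum_sum]
    refine Finset.sum_congr rfl fun z _ => ?_
    rw [hxSum_mul, mul_comm]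

end

section
variable {β κ X : Type} [Fintype β] [Nonempty β] [Fintype X] (Y : HxSys β κ X) {m : ℕ} (t : ℕ)

/-- One-step bound, for a fixed vertex and independent weight. -/
theorem HxSys.step_bound (c1 c2 d1 lam : ℝ) (hc1 : 0 ≤ c1) (hc2 : 0 ≤ c2) (hd1 : 0 ≤ d1)
    (hlam : 0 ≤ lam)
    (H1 : ∀ x, ∑ a, hxInd (Y.e1 a x) ≤ c1 * (Fintype.card β : ℝ))
    (H1' : ∀ x v, ∑ a, hxInd (Y.key a = v ∧ Y.e1 a x) ≤ d1 * (Fintype.card β : ℝ))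
    (H2 : ∀ x v, ∑ a, hxInd (Y.key a = v ∧ Y.e2 a x) ≤ c2 * (Fintype.card β : ℝ))
    (y : X) (U : Finset (Fin m)) (W : (Fin m → β) → ℝ) (hW0 : ∀ H, 0 ≤ W H)
    (hW : ∀ l ∉ U, ∀ H a, W (Function.update H l a) = W H) :
    ∑ i, ∑ j, (if i ∈ U then 1 else lam) * (if j ∈ U then 1 else lam) *
      ∑ H, W H * hxInd ((i ≠ j ∧ Y.key (H i) = Y.key (H j) ∧ Y.e1 (H i) y ∧ Y.e2 (H j) y) ∧
        Y.good t H U y) ≤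
    (lam ^ 2 * (m : ℝ) ^ 2 * (c1 * c2) + lam * U.card * (m * c2) + lam * U.card * (m * d1) +
      U.card * t) * ∑ H, W H := by
  classical
  set Z := ∑ H, W H with hZ
  have hZ0 : 0 ≤ Z := Finset.sum_nonneg fun H _ => hW0 H
  set T : Fin m → Fin m → ℝ := fun i j => ∑ H, W H * hxInd ((i ≠ j ∧ Y.key (H i) = Y.key (H j) ∧
    Y.e1 (H i) y ∧ Y.e2 (H j) y) ∧ Y.good t H U y) with hT
  -- second index new
  have new2 : ∀ (W' : (Fin m → β) → ℝ) (i j : Fin m), i ≠ j → (∀ H, 0 ≤ W' H) →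
      (∀ H a, W' (Function.update H j a) = W' H) →
      ∑ H, W' H * hxInd (Y.key (H j) = Y.key (H i) ∧ Y.e2 (H j) y) ≤ c2 * ∑ H, W' H := by
    intro W' i j hij h0 hinv
    refine hx_indep j W' (fun H a => hxInd (Y.key a = Y.key (H i) ∧ Y.e2 a y)) c2 h0 hinv ?_ ?_
    · intro H a b; rw [Function.update_of_ne hij]
    · intro H; exact H2 y _
  have hNN : ∀ i j, i ∉ U → j ∉ U → T i j ≤ c1 * c2 * Z := by
    intro i j hi hj
    by_cases hij : i = j
    · have : T i j = 0 := Finset.sum_eq_zero fun H _ => by rw [hxInd_false (by tauto)]; ring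
      rw [this]; positivity
    have s1 := new2 (fun H => W H * hxInd (Y.e1 (H i) y)) i j hij
      (fun H => mul_nonneg (hW0 H) (hxInd_nonneg _))
      (fun H a => by rw [hW j hj, Function.update_of_ne hij])
    have s2 := hx_indep i W (fun _ a => hxInd (Y.e1 a y)) c1 hW0 (hW i hi) (fun _ _ _ => rfl)
      (fun _ => H1 y)
    calc T i j ≤ ∑ H, W H * hxInd (Y.e1 (H i) y) *
          hxInd (Y.key (H j) = Y.key (H i) ∧ Y.e2 (H j) y) := by
          refine Finset.sum_le_sum fun H _ => ?_
          rw [mul_assoc, ← hxInd_and]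
          exact mul_le_mul_of_nonneg_left (hxInd_mono fun h => ⟨h.1.2.2.1, h.1.2.1.symm, h.1.2.2.2⟩)
            (hW0 H)
      _ ≤ c2 * (c1 * Z) := s1.trans (mul_le_mul_of_nonneg_left s2 hc2)
      _ = _ := by ring
  have hON : ∀ i j, i ∈ U → j ∉ U → T i j ≤ c2 * Z := by
    intro i j hi hj
    have hij : i ≠ j := fun h => hj (h ▸ hi)
    refine le_trans (Finset.sum_le_sum fun H _ => ?_) (new2 W i j hij hW0 (hW j hj))
    exact mul_le_mul_of_nonneg_left (hxInd_mono fun h => ⟨h.1.2.1.symm, h.1.2.2.2⟩) (hW0 H)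
  have hNO : ∀ i j, i ∉ U → j ∈ U → T i j ≤ d1 * Z := by
    intro i j hi hj
    have hij : j ≠ i := fun h => hi (h ▸ hj)
    refine le_trans (Finset.sum_le_sum fun H _ => ?_)
      (hx_indep i W (fun H a => hxInd (Y.key a = Y.key (H j) ∧ Y.e1 a y)) d1 hW0 (hW i hi)
        (fun H a b => by rw [Function.update_of_ne hij]) (fun H => H1' y _))
    exact mul_le_mul_of_nonneg_left (hxInd_mono fun h => ⟨h.1.2.1, h.1.2.2.1⟩) (hW0 H)
  have hOO : ∀ i ∈ U, ∑ j ∈ U, T i j ≤ t * Z := by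
    intro i hi
    rw [hT]
    simp only
    rw [Finset.sum_comm, hZ, Finset.mul_sum]
    refine Finset.sum_le_sum fun H _ => ?_
    rw [← Finset.mul_sum, mul_comm]
    refine mul_le_mul_of_nonneg_right ?_ (hW0 H)
    by_cases hg : Y.good t H U y
    · refine le_trans (Finset.sum_le_sum fun j _ => ?_) (hg (Y.key (H i)))
      exact hxInd_mono fun h => ⟨h.1.2.1.symm, h.1.2.2.2⟩
    · rw [Finset.sum_eq_zero fun j _ => hxInd_false (by tauto)]; positivity
  have hcardU : (Uᶜ.card : ℝ) ≤ m := by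
    have := Finset.card_le_univ Uᶜ
    rw [Fintype.card_fin] at this
    exact_mod_cast this
  have hT0 : ∀ i j, 0 ≤ T i j := fun i j => Finset.sum_nonneg fun H _ =>
    mul_nonneg (hW0 H) (hxInd_nonneg _)
  have inner : ∀ i, ∑ j, (if i ∈ U then 1 else lam) * (if j ∈ U then 1 else lam) * T i j =
      (if i ∈ U then 1 else lam) * (∑ j ∈ U, T i j + lam * ∑ j ∈ Uᶜ, T i j) := by
    intro i
    rw [← Finset.sum_add_sum_compl U, mul_add, Finset.mul_sum, Finset.mul_sum, Finset.mul_sum]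
    congr 1
    · refine Finset.sum_congr rfl fun j hj => by simp [hj]
    · refine Finset.sum_congr rfl fun j hj => ?_
      simp only [Finset.mem_compl] at hj
      simp [hj]; ring
  change ∑ i, ∑ j, (if i ∈ U then 1 else lam) * (if j ∈ U then 1 else lam) * T i j ≤ _
  simp only [inner]
  rw [← Finset.sum_add_sum_compl U]
  have A1 : ∑ i ∈ U, (if i ∈ U then 1 else lam) * (∑ j ∈ U, T i j + lam * ∑ j ∈ Uᶜ, T i j) ≤
      ∑ i ∈ U, (t * Z + lam * (m * (c2 * Z))) := by
    refine Finset.sum_le_sum fun i hi => ?_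
    rw [if_pos hi, one_mul]
    refine add_le_add (hOO i hi) (mul_le_mul_of_nonneg_left ?_ hlam)
    calc ∑ j ∈ Uᶜ, T i j ≤ ∑ j ∈ Uᶜ, c2 * Z :=
          Finset.sum_le_sum fun j hj => hON i j hi (Finset.mem_compl.1 hj)
      _ = Uᶜ.card * (c2 * Z) := by rw [Finset.sum_const, nsmul_eq_mul]
      _ ≤ _ := by gcongr
  have A2 : ∑ i ∈ Uᶜ, (if i ∈ U then 1 else lam) * (∑ j ∈ U, T i j + lam * ∑ j ∈ Uᶜ, T i j) ≤
      ∑ i ∈ Uᶜ, lam * (U.card * (d1 * Z) + lam * (m * (c1 * c2 * Z))) := by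
    refine Finset.sum_le_sum fun i hi => ?_
    have hi' := Finset.mem_compl.1 hi
    rw [if_neg hi']
    refine mul_le_mul_of_nonneg_left (add_le_add ?_ (mul_le_mul_of_nonneg_left ?_ hlam)) hlam
    · calc ∑ j ∈ U, T i j ≤ ∑ j ∈ U, d1 * Z :=
          Finset.sum_le_sum fun j hj => hNO i j hi' hj
        _ = _ := by rw [Finset.sum_const, nsmul_eq_mul]
    · calc ∑ j ∈ Uᶜ, T i j ≤ ∑ j ∈ Uᶜ, c1 * c2 * Z :=
          Finset.sum_le_sum fun j hj => hNN i j hi' (Finset.mem_compl.1 hj)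
        _ = Uᶜ.card * (c1 * c2 * Z) := by rw [Finset.sum_const, nsmul_eq_mul]
        _ ≤ _ := by gcongr
  rw [Finset.sum_const, nsmul_eq_mul] at A1 A2
  have A3 : (Uᶜ.card : ℝ) * (lam * (U.card * (d1 * Z) + lam * (m * (c1 * c2 * Z)))) ≤
      m * (lam * (U.card * (d1 * Z) + lam * (m * (c1 * c2 * Z)))) := by gcongr
  calc _ ≤ _ := add_le_add A1 (A2.trans A3)
    _ = _ := by ring

theorem HxSys.moment [DecidableEq X] (c1 c2 d1 lam F : ℝ) (hc1 : 0 ≤ c1) (hc2 : 0 ≤ c2)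
    (hd1 : 0 ≤ d1) (hlam : 0 < lam) (hlam1 : lam ≤ 1)
    (H1 : ∀ x, ∑ a, hxInd (Y.e1 a x) ≤ c1 * (Fintype.card β : ℝ))
    (H1' : ∀ x v, ∑ a, hxInd (Y.key a = v ∧ Y.e1 a x) ≤ d1 * (Fintype.card β : ℝ))
    (H2 : ∀ x v, ∑ a, hxInd (Y.key a = v ∧ Y.e2 a x) ≤ c2 * (Fintype.card β : ℝ))
    (Hs : ∀ a b x, ∑ y, hxInd (Y.step a b x y) ≤ hxInd (Y.e1 a x ∧ Y.e2 b x))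
    (P : ℕ)
    (hF : lam ^ 2 * (m : ℝ) ^ 2 * (c1 * c2) + lam * (2 * P) * (m * c2) + lam * (2 * P) * (m * d1) +
      (2 * P) * t ≤ F) :
    ∑ H : Fin m → β, ∑ τ : Fin m → Bool, ((Y.A t H τ) ^ P).trace ≤
      (2 : ℝ) ^ m * (Fintype.card β : ℝ) ^ m * Fintype.card X * (F / lam) ^ P := by
  classical
  -- the potential
  set T : X → List (Fin m × Fin m) → ℝ := fun x s => lam ^ (hxFlat s).toFinset.card *
    ∑ H : Fin m → β, ∑ y, Y.V t H s x y with hT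
  have hT0 : ∀ x s, 0 ≤ T x s := fun x s => mul_nonneg (by positivity)
    (Finset.sum_nonneg fun H _ => Finset.sum_nonneg fun y _ => Y.V_nonneg t H s x y)
  have hF0 : 0 ≤ F := le_trans (by positivity) hF
  have one : ∀ x s, s.length ≤ P → ∑ e, T x (e :: s) ≤ F * T x s := by
    intro x s hs
    set U := (hxFlat s).toFinset with hU
    have hUc : (U.card : ℝ) ≤ 2 * P := by
      have h1 := List.toFinset_card_le (hxFlat s)
      rw [hxFlat_length, ← hU] at h1
      have : U.card ≤ 2 * P := by omega
      exact_mod_cast this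
    have hinv : ∀ y, ∀ l ∉ U, ∀ (H : Fin m → β) a,
        Y.V t (Function.update H l a) s x y = Y.V t H s x y := by
      intro y l hl H a
      refine Y.V_congr t s (fun j hj => ?_) x y
      rw [Function.update_of_ne]
      rintro rfl; exact hl (List.mem_toFinset.2 hj)
    have hb := fun y => Y.step_bound t c1 c2 d1 lam hc1 hc2 hd1 hlam.le H1 H1' H2 y U
      (fun H => Y.V t H s x y) (fun H => Y.V_nonneg t H s x y) (hinv y)
    have hterm : ∀ i j, T x ((i, j) :: s) ≤ lam ^ U.card * ∑ y,
        ((if i ∈ U then 1 else lam) * (if j ∈ U then 1 else lam) *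
        ∑ H, Y.V t H s x y * hxInd ((i ≠ j ∧ Y.key (H i) = Y.key (H j) ∧ Y.e1 (H i) y ∧
          Y.e2 (H j) y) ∧ Y.good t H U y)) := by
      intro i j
      by_cases hij : i = j
      · have : T x ((i, j) :: s) = 0 := by
          rw [hT]
          simp only [HxSys.V, HxSys.c']
          rw [Finset.sum_eq_zero, mul_zero]
          intro H _
          refine Finset.sum_eq_zero fun y' _ => Finset.sum_eq_zero fun y _ => ?_
          rw [hxInd_false (by tauto), mul_zero]
        rw [this]
        refine mul_nonneg (by positivity) (Finset.sum_nonneg fun y _ => mul_nonneg ?_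
          (Finset.sum_nonneg fun H _ => mul_nonneg (Y.V_nonneg t H s x y) (hxInd_nonneg _)))
        split_ifs <;> positivity
      have hcard : lam ^ (hxFlat ((i, j) :: s)).toFinset.card =
          lam ^ U.card * ((if i ∈ U then 1 else lam) * (if j ∈ U then 1 else lam)) := by
        simp only [hxFlat, List.toFinset_cons, ← hU]
        by_cases hj : j ∈ U
        · rw [Finset.insert_eq_of_mem hj]
          by_cases hi : i ∈ U
          · rw [Finset.insert_eq_of_mem hi]; simp [hi, hj]
          · rw [Finset.card_insert_of_notMem hi]; simp [hi, hj, pow_succ]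
        · by_cases hi : i ∈ U
          · rw [Finset.insert_eq_of_mem (Finset.mem_insert_of_mem hi),
              Finset.card_insert_of_notMem hj]; simp [hi, hj, pow_succ]
          · rw [Finset.card_insert_of_notMem (by simp [hi, hij]),
              Finset.card_insert_of_notMem hj]; simp [hi, hj, pow_succ]; ring
      rw [hT]
      simp only
      rw [hcard, mul_assoc]
      refine mul_le_mul_of_nonneg_left ?_ (by positivity)
      rw [← Finset.mul_sum]
      refine mul_le_mul_of_nonneg_left ?_ (by split_ifs <;> positivity)
      rw [Finset.sum_comm (s := univ) (t := univ) (f := fun y H => Y.V t H s x y * _)]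
      refine Finset.sum_le_sum fun H _ => ?_
      simp only [HxSys.V]
      rw [Finset.sum_comm]
      refine Finset.sum_le_sum fun y _ => ?_
      rw [← Finset.mul_sum]
      refine mul_le_mul_of_nonneg_left ?_ (Y.V_nonneg t H s x y)
      simp only [HxSys.c']
      by_cases hq : (i ≠ j ∧ Y.key (H i) = Y.key (H j)) ∧ Y.good t H U y
      · calc _ ≤ ∑ y', hxInd (Y.step (H i) (H j) y y') :=
              Finset.sum_le_sum fun y' _ => hxInd_mono fun h => h.1.2.2
          _ ≤ _ := Hs _ _ _
          _ ≤ _ := hxInd_mono fun h => ⟨⟨hq.1.1, hq.1.2, h.1, h.2⟩, hq.2⟩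
      · rw [Finset.sum_eq_zero fun y' _ => hxInd_false (by tauto)]
        exact hxInd_nonneg _
    rw [Fintype.sum_prod_type]
    calc ∑ i, ∑ j, T x ((i, j) :: s) ≤ ∑ i, ∑ j, lam ^ U.card * ∑ y,
        ((if i ∈ U then 1 else lam) * (if j ∈ U then 1 else lam) *
        ∑ H, Y.V t H s x y * hxInd ((i ≠ j ∧ Y.key (H i) = Y.key (H j) ∧ Y.e1 (H i) y ∧
          Y.e2 (H j) y) ∧ Y.good t H U y)) :=
          Finset.sum_le_sum fun i _ => Finset.sum_le_sum fun j _ => hterm i j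
      _ = lam ^ U.card * ∑ y, ∑ i, ∑ j,
        ((if i ∈ U then 1 else lam) * (if j ∈ U then 1 else lam) *
        ∑ H, Y.V t H s x y * hxInd ((i ≠ j ∧ Y.key (H i) = Y.key (H j) ∧ Y.e1 (H i) y ∧
          Y.e2 (H j) y) ∧ Y.good t H U y)) := by
          simp only [Finset.mul_sum]
          conv_rhs => rw [Finset.sum_comm]
          refine Finset.sum_congr rfl fun i _ => ?_
          conv_rhs => rw [Finset.sum_comm]
      _ ≤ lam ^ U.card * ∑ y, F * ∑ H, Y.V t H s x y := by
          refine mul_le_mul_of_nonneg_left (Finset.sum_le_sum fun y _ => (hb y).trans ?_)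
            (by positivity)
          refine mul_le_mul_of_nonneg_right (le_trans ?_ hF)
            (Finset.sum_nonneg fun H _ => Y.V_nonneg t H s x y)
          gcongr
      _ = F * T x s := by
          rw [← Finset.mul_sum, hT]
          simp only
          rw [Finset.sum_comm]; ring
  have iter : ∀ x p, p ≤ P → hxSum p (T x) ≤ F ^ p * (Fintype.card β : ℝ) ^ m := by
    intro x p
    induction p with
    | zero =>
      intro _
      simp only [hxSum, hT, hxFlat, HxSys.V]
      have h1 : ∑ y, hxInd (x = y) = 1 := by
        rw [Finset.sum_eq_single x (fun y _ hy => hxInd_false (Ne.symm hy)) (by simp)]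
        exact hxInd_true rfl
      simp [h1]
    | succ p ih =>
      intro hp
      rw [hxSum_succ]
      calc _ ≤ hxSum p (fun s => F * T x s) := hxSum_le _ _ _ fun s hs => one x s (by omega)
        _ = F * hxSum p (T x) := hxSum_mul _ _ _
        _ ≤ F * (F ^ p * (Fintype.card β : ℝ) ^ m) :=
          mul_le_mul_of_nonneg_left (ih (by omega)) hF0
        _ = _ := by ring
  have main : ∀ x, ∑ H : Fin m → β, ∑ τ : Fin m → Bool, ((Y.A t H τ) ^ P) x x ≤
      2 ^ m * (1 / lam) ^ P * hxSum P (T x) := by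
    intro x
    simp only [HxSys.A_pow]
    simp only [← hxSum_sum]
    rw [← hxSum_mul]
    refine hxSum_le _ _ _ fun s hs => ?_
    calc ∑ H, ∑ τ : Fin m → Bool, ((hxFlat s).map fun j => hxSg (τ j)).prod * Y.B t H s x x
        = ∑ H, (∑ τ : Fin m → Bool, ((hxFlat s).map fun j => hxSg (τ j)).prod) *
            Y.B t H s x x := by simp only [Finset.sum_mul]
      _ ≤ ∑ H, (2 ^ m * ((1 / lam) ^ P * lam ^ (hxFlat s).toFinset.card)) *
            ∑ y, Y.V t H s x y := by
          refine Finset.sum_le_sum fun H _ => mul_le_mul ?_ ?_ (Y.B_nonneg t H s x x)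
            (by positivity)
          · refine (hx_sign_sum _).trans (mul_le_mul_of_nonneg_left ?_ (by positivity))
            rw [hxFlat_length, hs]
            by_cases h : 2 * (hxFlat s).toFinset.card ≤ 2 * P
            · rw [hxInd_true h, one_div, inv_pow, inv_mul_eq_div, le_div_iff₀ (by positivity),
                one_mul]
              exact pow_le_pow_of_le_one hlam.le hlam1 (by omega)
            · rw [hxInd_false h]; positivity
          · exact (Y.B_le_V t H s x x).trans (Finset.single_le_sum (f := fun y => Y.V t H s x y)
              (fun y _ => Y.V_nonneg t H s x y) (Finset.mem_univ x))
      _ = _ := by rw [← Finset.mul_sum, hT]; ring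
  calc ∑ H : Fin m → β, ∑ τ : Fin m → Bool, ((Y.A t H τ) ^ P).trace
      = ∑ x, ∑ H : Fin m → β, ∑ τ : Fin m → Bool, ((Y.A t H τ) ^ P) x x := by
        simp only [Matrix.trace, Matrix.diag]
        rw [Finset.sum_comm]
        conv_lhs => rw [Finset.sum_comm]
        conv_rhs => rw [Finset.sum_comm]
        refine Finset.sum_congr rfl fun H _ => ?_
        rw [Finset.sum_comm]
    _ ≤ ∑ x : X, 2 ^ m * (1 / lam) ^ P * (F ^ P * (Fintype.card β : ℝ) ^ m) :=
        Finset.sum_le_sum fun x _ => (main x).trans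
          (mul_le_mul_of_nonneg_left (iter x P le_rfl) (by positivity))
    _ = _ := by
        rw [Finset.sum_const, Finset.card_univ, nsmul_eq_mul, div_pow, div_pow, one_pow]; ring

end

/-- A bad vertex witnesses many colliding indices outside of any given pair. -/
theorem HxSys.bad_witness {β κ X : Type} (Y : HxSys β κ X) {m : ℕ} {t q : ℕ} (hq : q + 1 ≤ t)
    (H : Fin m → β) (x : X) (h : ¬ Y.good t H univ x) (i j : Fin m) :
    ∃ v, ∃ I ⊆ (univ \ {i, j} : Finset (Fin m)), I.card = q ∧
      ∀ l ∈ I, Y.key (H l) = v ∧ Y.e2 (H l) x := by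
  classical
  unfold HxSys.good at h
  push Not at h
  obtain ⟨v, hv⟩ := h
  rw [hx_sum_ind] at hv
  refine ⟨v, ?_⟩
  set Q := (univ : Finset (Fin m)).filter (fun j => Y.key (H j) = v ∧ Y.e2 (H j) x) with hQ
  have h1 : t < Q.card := by exact_mod_cast hv
  have h2 : q ≤ (Q \ {i, j}).card := by
    have := Finset.le_card_sdiff {i, j} Q
    have h3 : ({i, j} : Finset (Fin m)).card ≤ 2 := Finset.card_le_two
    omega
  obtain ⟨I, hI, hc⟩ := Finset.exists_subset_card_eq h2
  refine ⟨I, hI.trans (Finset.sdiff_subset_sdiff (Finset.subset_univ _) le_rfl), hc, ?_⟩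
  intro l hl
  have := Finset.mem_sdiff.1 (hI hl)
  exact (Finset.mem_filter.1 this.1).2

theorem HxSys.bad_edges {β κ X : Type} [Fintype β] [Nonempty β] [Fintype X] [Fintype κ]
    (Y : HxSys β κ X) {m : ℕ} {t q : ℕ}
    (hq : q + 1 ≤ t)
    (c1 c2 : ℝ) (hc1 : 0 ≤ c1) (hc2 : 0 ≤ c2)
    (H1 : ∀ x, ∑ a, hxInd (Y.e1 a x) ≤ c1 * (Fintype.card β : ℝ))
    (H2 : ∀ x v, ∑ a, hxInd (Y.key a = v ∧ Y.e2 a x) ≤ c2 * (Fintype.card β : ℝ))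
    (Hs : ∀ a b x, ∑ y, hxInd (Y.step a b x y) ≤ hxInd (Y.e1 a x ∧ Y.e2 b x)) :
    ∑ H : Fin m → β, ∑ e : Fin m × Fin m, ∑ x, ∑ y,
      hxInd ((e.1 ≠ e.2 ∧ Y.key (H e.1) = Y.key (H e.2) ∧ Y.step (H e.1) (H e.2) x y) ∧
        ¬ Y.good t H univ x) ≤
    (Fintype.card X : ℝ) * ((m : ℝ) ^ 2 * (c1 * c2)) * (Fintype.card κ *
      ((m * c2) ^ q / q.factorial)) * (Fintype.card β : ℝ) ^ m := by
  classical
  have per : ∀ (e : Fin m × Fin m) (x : X), ∑ H : Fin m → β, ∑ y,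
      hxInd ((e.1 ≠ e.2 ∧ Y.key (H e.1) = Y.key (H e.2) ∧ Y.step (H e.1) (H e.2) x y) ∧
        ¬ Y.good t H univ x) ≤ (c1 * c2) * (Fintype.card κ *
      ((m * c2) ^ q / q.factorial)) * (Fintype.card β : ℝ) ^ m := by
    rintro ⟨i, j⟩ x
    by_cases hij : i = j
    · rw [Finset.sum_eq_zero]
      · positivity
      · intro H _
        exact Finset.sum_eq_zero fun y _ => hxInd_false (by tauto)
    -- the weight of the edge
    set W : (Fin m → β) → ℝ := fun H =>
      hxInd (Y.e1 (H i) x) * hxInd (Y.key (H j) = Y.key (H i) ∧ Y.e2 (H j) x) with hW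
    have hW0 : ∀ H, 0 ≤ W H := fun H => mul_nonneg (hxInd_nonneg _) (hxInd_nonneg _)
    have hWs : ∑ H, W H ≤ c1 * c2 * (Fintype.card β : ℝ) ^ m := by
      have s1 := hx_indep j (fun H => hxInd (Y.e1 (H i) x))
        (fun H a => hxInd (Y.key a = Y.key (H i) ∧ Y.e2 a x)) c2
        (fun H => hxInd_nonneg _) (fun H a => by rw [Function.update_of_ne hij])
        (fun H a b => by rw [Function.update_of_ne hij]) (fun H => H2 x _)
      have s2 := hx_indep i (fun _ : Fin m → β => (1 : ℝ)) (fun _ a => hxInd (Y.e1 a x)) c1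
        (fun _ => zero_le_one) (fun _ _ => rfl) (fun _ _ _ => rfl) (fun _ => H1 x)
      simp only [one_mul, Finset.sum_const, Finset.card_univ, nsmul_eq_mul, mul_one,
        Fintype.card_fun, Fintype.card_fin, Nat.cast_pow] at s2
      calc _ ≤ _ := s1
        _ ≤ c2 * (c1 * (Fintype.card β : ℝ) ^ m) := mul_le_mul_of_nonneg_left s2 hc2
        _ = _ := by ring
    have tl := fun v => hx_tail (univ \ {i, j}) W (fun a => Y.key a = v ∧ Y.e2 a x) c2 hc2 hW0
      (fun l hl H a => by
        simp only [Finset.mem_sdiff, Finset.mem_insert, Finset.mem_singleton, not_or] at hl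
        simp only [hW]
        rw [Function.update_of_ne (Ne.symm hl.2.1), Function.update_of_ne (Ne.symm hl.2.2)])
      (H2 x v) q
    calc _ ≤ ∑ H : Fin m → β, W H * ∑ v, hxInd (∃ I ⊆ (univ \ {i, j} : Finset (Fin m)),
          I.card = q ∧ ∀ l ∈ I, Y.key (H l) = v ∧ Y.e2 (H l) x) := by
          refine Finset.sum_le_sum fun H _ => ?_
          have hnn : ∀ v ∈ (univ : Finset κ), 0 ≤ hxInd (∃ I ⊆ (univ \ {i, j} : Finset (Fin m)),
            I.card = q ∧ ∀ l ∈ I, Y.key (H l) = v ∧ Y.e2 (H l) x) := fun _ _ => hxInd_nonneg _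
          by_cases hg : Y.good t H univ x
          · rw [Finset.sum_eq_zero fun y _ => hxInd_false (by tauto)]
            exact mul_nonneg (hW0 H) (Finset.sum_nonneg hnn)
          by_cases hk : Y.key (H i) = Y.key (H j)
          · have hge : (1 : ℝ) ≤ ∑ v, hxInd (∃ I ⊆ (univ \ {i, j} : Finset (Fin m)),
                I.card = q ∧ ∀ l ∈ I, Y.key (H l) = v ∧ Y.e2 (H l) x) := by
              obtain ⟨v, hv⟩ := Y.bad_witness hq H x hg i j
              rw [← hxInd_true hv]
              exact Finset.single_le_sum hnn (Finset.mem_univ v)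
            calc _ ≤ ∑ y, hxInd (Y.step (H i) (H j) x y) :=
                  Finset.sum_le_sum fun y _ => hxInd_mono fun h => h.1.2.2
              _ ≤ _ := Hs _ _ _
              _ = W H := by
                rw [hW]; simp only
                rw [← hxInd_and]; exact hxInd_congr (by simp [hk])
              _ = W H * 1 := (mul_one _).symm
              _ ≤ _ := mul_le_mul_of_nonneg_left hge (hW0 H)
          · rw [Finset.sum_eq_zero fun y _ => hxInd_false (by tauto)]
            exact mul_nonneg (hW0 H) (Finset.sum_nonneg hnn)
      _ = ∑ v, ∑ H : Fin m → β, W H * hxInd (∃ I ⊆ (univ \ {i, j} : Finset (Fin m)),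
          I.card = q ∧ ∀ l ∈ I, Y.key (H l) = v ∧ Y.e2 (H l) x) := by
          simp only [Finset.mul_sum]; rw [Finset.sum_comm]
      _ ≤ ∑ v : κ, (((m : ℝ) * c2) ^ q / (q.factorial : ℝ)) *
            (c1 * c2 * (Fintype.card β : ℝ) ^ m) :=
          Finset.sum_le_sum fun v _ => (tl v).trans
            (mul_le_mul_of_nonneg_left hWs (by positivity))
      _ = _ := by rw [Finset.sum_const, Finset.card_univ, nsmul_eq_mul]; ring
  calc _ = ∑ e : Fin m × Fin m, ∑ x, ∑ H : Fin m → β, ∑ y,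
      hxInd ((e.1 ≠ e.2 ∧ Y.key (H e.1) = Y.key (H e.2) ∧ Y.step (H e.1) (H e.2) x y) ∧
        ¬ Y.good t H univ x) := by
        rw [Finset.sum_comm]
        refine Finset.sum_congr rfl fun e _ => ?_
        rw [Finset.sum_comm]
    _ ≤ ∑ e : Fin m × Fin m, ∑ x : X, (c1 * c2) * (Fintype.card κ *
      ((m * c2) ^ q / q.factorial)) * (Fintype.card β : ℝ) ^ m :=
        Finset.sum_le_sum fun e _ => Finset.sum_le_sum fun x _ => per e x
    _ = _ := by
        simp only [Finset.sum_const, Finset.card_univ, nsmul_eq_mul, Fintype.card_prod,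
          Fintype.card_fin]
        push_cast; ring

theorem hx_count {k n : ℕ} (D : Fin k → Finset (Fin n)) (w : Fin k → ℝ)
    (hw : ∀ j, ((D j).card : ℝ) ≤ w j * n) :
    ∑ C : Fin k → Fin n, hxInd (∀ j, C j ∈ D j) ≤
      (∏ j, w j) * (Fintype.card (Fin k → Fin n) : ℝ) := by
  classical
  rw [hx_sum_ind]
  have : (univ.filter fun C : Fin k → Fin n => ∀ j, C j ∈ D j) = Fintype.piFinset D := by
    ext C; simp [Fintype.mem_piFinset]
  rw [this, Fintype.card_piFinset]
  push_cast
  calc ∏ j, ((D j).card : ℝ) ≤ ∏ j, (w j * n) :=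
        Finset.prod_le_prod (fun _ _ => by positivity) (fun j _ => hw j)
    _ = _ := by rw [Finset.prod_mul_distrib]; simp

/-- First block of positions. -/
def hxJ1 (k : ℕ) : Finset (Fin k) := univ.filter fun j => 1 ≤ j.val ∧ j.val ≤ k / 2
/-- Second block of positions. -/
def hxJ2 (k : ℕ) : Finset (Fin k) := univ.filter fun j => k / 2 < j.val

theorem hxJ_disj (k : ℕ) : Disjoint (hxJ1 k) (hxJ2 k) := by
  rw [Finset.disjoint_left]; intro j h1 h2
  simp only [hxJ1, hxJ2, Finset.mem_filter] at h1 h2; omega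

theorem hxJ2_card (k : ℕ) (hk : 2 ≤ k) : (hxJ2 k).card = k - 1 - k / 2 := by
  have : hxJ2 k = Finset.Ioi (⟨k / 2, by omega⟩ : Fin k) := by
    ext j; simp [hxJ2, Fin.lt_def]
  rw [this, Fin.card_Ioi]

theorem hxJ1_card (k : ℕ) (hk : 2 ≤ k) : (hxJ1 k).card = k / 2 := by
  have : hxJ1 k = Finset.Ioc (⟨0, by omega⟩ : Fin k) (⟨k / 2, by omega⟩ : Fin k) := by
    ext j; simp [hxJ1, Fin.lt_def, Fin.le_def]; omega
  rw [this, Fin.card_Ioc]; simp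

theorem hxJ_zero (k : ℕ) [NeZero k] : (univ : Finset (Fin k)) = insert 0 (hxJ1 k ∪ hxJ2 k) := by
  ext j
  simp only [mem_univ, mem_insert, mem_union, hxJ1, hxJ2, mem_filter, true_and, true_iff]
  by_cases h : j = 0
  · exact Or.inl h
  · right
    have : j.val ≠ 0 := fun h' => h (Fin.ext (by simpa using h'))
    omega

theorem hxJ_zero1 (k : ℕ) [NeZero k] : (0 : Fin k) ∉ hxJ1 k := by simp [hxJ1]
theorem hxJ_zero2 (k : ℕ) [NeZero k] : (0 : Fin k) ∉ hxJ2 k := by simp [hxJ2]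

/-- Relation between a tuple and a pair of sets. -/
def hxRel {k n : ℕ} (C : Fin k → Fin n) (S T : Finset (Fin n)) : Prop :=
  Set.InjOn C (hxJ1 k ∪ hxJ2 k : Finset (Fin k)) ∧ (hxJ1 k).image C ⊆ S ∧ (hxJ2 k).image C ⊆ T ∧
    S \ (hxJ1 k).image C = T \ (hxJ2 k).image C

theorem hxRel_right {k n : ℕ} {C : Fin k → Fin n} {S T T' : Finset (Fin n)}
    (h : hxRel C S T) (h' : hxRel C S T') : T = T' := by
  rw [← Finset.sdiff_union_of_subset h.2.2.1, ← Finset.sdiff_union_of_subset h'.2.2.1,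
    ← h.2.2.2, ← h'.2.2.2]

theorem hxRel_left {k n : ℕ} {C : Fin k → Fin n} {S S' T : Finset (Fin n)}
    (h : hxRel C S T) (h' : hxRel C S' T) : S = S' := by
  rw [← Finset.sdiff_union_of_subset h.2.1, ← Finset.sdiff_union_of_subset h'.2.1,
    h.2.2.2, h'.2.2.2]

/-- Vertices. -/
abbrev HxX (n s s' : ℕ) : Type :=
  {S : Finset (Fin n) // S.card = s} × {T : Finset (Fin n) // T.card = s'}

def hxK (k n s s' : ℕ) [NeZero k] : HxSys (Fin k → Fin n) (Fin n) (HxX n s s') where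
  key C := C 0
  e1 C x := ∀ j ∈ hxJ1 k, C j ∈ x.1.1
  e2 C x := ∀ j ∈ hxJ2 k, C j ∈ x.2.1
  step C C' x y := hxRel C x.1.1 y.2.1 ∧ hxRel C' y.1.1 x.2.1

theorem hxK_symm (k n s s' : ℕ) [NeZero k] (a b : Fin k → Fin n) (x y : HxX n s s') :
    (hxK k n s s').step a b x y ↔ (hxK k n s s').step b a y x := and_comm

theorem hxK_Hs (k n s s' : ℕ) [NeZero k] (a b : Fin k → Fin n) (x : HxX n s s') :
    ∑ y, hxInd ((hxK k n s s').step a b x y) ≤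
      hxInd ((hxK k n s s').e1 a x ∧ (hxK k n s s').e2 b x) := by
  classical
  by_cases h : ∃ y, (hxK k n s s').step a b x y
  · obtain ⟨y, hy⟩ := h
    rw [Finset.sum_eq_single y, hxInd_true hy, hxInd_true]
    · refine ⟨fun j hj => hy.1.2.1 (Finset.mem_image_of_mem _ hj),
        fun j hj => hy.2.2.2.1 (Finset.mem_image_of_mem _ hj)⟩
    · intro y' _ hne
      refine hxInd_false fun hy' => hne ?_
      exact Prod.ext (Subtype.ext (hxRel_left hy'.2 hy.2)) (Subtype.ext (hxRel_right hy'.1 hy.1))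
    · simp
  · rw [Finset.sum_eq_zero]
    · exact hxInd_nonneg _
    · intro y _; exact hxInd_false fun hy => h ⟨y, hy⟩

section
variable (k n s s' : ℕ) [NeZero k] (r : ℝ)

theorem hxK_H1 (hs : (s : ℝ) ≤ r * n) (x : HxX n s s') :
    ∑ a, hxInd ((hxK k n s s').e1 a x) ≤
      (r ^ (hxJ1 k).card) * (Fintype.card (Fin k → Fin n) : ℝ) := by
  classical
  have h := hx_count (k := k) (fun j => if j ∈ hxJ1 k then x.1.1 else univ)
    (fun j => if j ∈ hxJ1 k then r else 1) (fun j => by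
      split_ifs
      · rw [x.1.2]; exact hs
      · simp)
  have e : ∏ j, (if j ∈ hxJ1 k then r else 1) = r ^ (hxJ1 k).card := by
    rw [Finset.prod_ite]; simp
  rw [e] at h
  refine le_trans (Finset.sum_le_sum fun a _ => hxInd_mono ?_) h
  intro ha j
  split_ifs with hj
  · exact ha j hj
  · simp

theorem hxK_key_count (J : Finset (Fin k)) (h0 : (0 : Fin k) ∉ J) (S : Finset (Fin n))
    (hn : 0 < n) (hs : (S.card : ℝ) ≤ r * n) (v : Fin n) :
    ∑ a : Fin k → Fin n, hxInd (a 0 = v ∧ ∀ j ∈ J, a j ∈ S) ≤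
      (r ^ J.card / n) * (Fintype.card (Fin k → Fin n) : ℝ) := by
  classical
  have hn' : (n : ℝ) ≠ 0 := by positivity
  have h := hx_count (k := k) (fun j => if j = 0 then {v} else if j ∈ J then S else univ)
    (fun j => (if j = 0 then (n : ℝ)⁻¹ else 1) * if j ∈ J then r else 1) (fun j => by
      by_cases hj : j = 0
      · subst hj; simp [h0, hn']
      · by_cases hj' : j ∈ J
        · simpa [hj, hj'] using hs
        · simp [hj, hj'])
  have e : ∏ j : Fin k, ((if j = 0 then (n : ℝ)⁻¹ else 1) * if j ∈ J then r else 1) =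
      r ^ J.card / n := by
    rw [Finset.prod_mul_distrib, Finset.prod_ite_eq']
    simp only [mem_univ, if_true]
    rw [Finset.prod_ite]; simp; field_simp
  rw [e] at h
  refine le_trans (Finset.sum_le_sum fun a _ => hxInd_mono ?_) h
  rintro ⟨ha0, ha⟩ j
  by_cases hj : j = 0
  · subst hj; simp [ha0]
  · by_cases hj' : j ∈ J
    · simpa [hj, hj'] using ha j hj'
    · simp [hj, hj']

theorem hxK_H1' (hn : 0 < n) (hs : (s : ℝ) ≤ r * n) (x : HxX n s s') (v : Fin n) :
    ∑ a, hxInd ((hxK k n s s').key a = v ∧ (hxK k n s s').e1 a x) ≤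
      (r ^ (hxJ1 k).card / n) * (Fintype.card (Fin k → Fin n) : ℝ) :=
  hxK_key_count k n r (hxJ1 k) (hxJ_zero1 k) x.1.1 hn (by rw [x.1.2]; exact hs) v

theorem hxK_H2 (hn : 0 < n) (hs : (s' : ℝ) ≤ r * n) (x : HxX n s s') (v : Fin n) :
    ∑ a, hxInd ((hxK k n s s').key a = v ∧ (hxK k n s s').e2 a x) ≤
      (r ^ (hxJ2 k).card / n) * (Fintype.card (Fin k → Fin n) : ℝ) :=
  hxK_key_count k n r (hxJ2 k) (hxJ_zero2 k) x.2.1 hn (by rw [x.2.2]; exact hs) v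
end

/-- Number of pairs of sets related to an injective tuple. -/
theorem hxRel_count {k n b s s' : ℕ} (C : Fin k → Fin n)
    (hC : Set.InjOn C (hxJ1 k ∪ hxJ2 k : Finset (Fin k)))
    (hs : s = b + (hxJ1 k).card) (hs' : s' = b + (hxJ2 k).card) :
    ∑ p : HxX n s s', hxInd (hxRel C p.1.1 p.2.1) =
      ((n - ((hxJ1 k).card + (hxJ2 k).card)).choose b : ℝ) := by
  classical
  set U1 := (hxJ1 k).image C with hU1
  set U2 := (hxJ2 k).image C with hU2
  have c1 : U1.card = (hxJ1 k).card := Finset.card_image_of_injOn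
    (hC.mono (by simp))
  have c2 : U2.card = (hxJ2 k).card := Finset.card_image_of_injOn
    (hC.mono (by simp))
  have hd : Disjoint U1 U2 := by
    rw [Finset.disjoint_left]
    intro a h1 h2
    obtain ⟨i, hi, rfl⟩ := Finset.mem_image.1 h1
    obtain ⟨j, hj, hij⟩ := Finset.mem_image.1 h2
    have := hC (by simp [hj]) (by simp [hi]) hij
    subst this
    exact Finset.disjoint_left.1 (hxJ_disj k) hi hj
  have cU : (U1 ∪ U2).card = (hxJ1 k).card + (hxJ2 k).card := by
    rw [Finset.card_union_of_disjoint hd, c1, c2]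
  rw [hx_sum_ind, ← cU]
  have hcard : (univ \ (U1 ∪ U2) : Finset (Fin n)).card = n - (U1 ∪ U2).card := by
    rw [Finset.card_sdiff_of_subset (Finset.subset_univ _)]; simp
  rw [← hcard, ← Finset.card_powersetCard]
  norm_cast
  refine Finset.card_bij' (fun p _ => p.1.1 \ U1)
    (fun R hR => (⟨R ∪ U1, ?_⟩, ⟨R ∪ U2, ?_⟩)) ?_ ?_ ?_ ?_
  · rw [Finset.mem_powersetCard] at hR
    rw [Finset.card_union_of_disjoint, hR.2, c1, hs]
    exact Finset.disjoint_of_subset_left hR.1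
      (Finset.disjoint_of_subset_right Finset.subset_union_left Finset.sdiff_disjoint)
  · rw [Finset.mem_powersetCard] at hR
    rw [Finset.card_union_of_disjoint, hR.2, c2, hs']
    exact Finset.disjoint_of_subset_left hR.1
      (Finset.disjoint_of_subset_right Finset.subset_union_right Finset.sdiff_disjoint)
  · intro p hp
    obtain ⟨_, h1, h2, h3⟩ := (Finset.mem_filter.1 hp).2
    rw [Finset.mem_powersetCard]
    constructor
    · intro a ha
      have hb : a ∈ p.2.1 \ U2 := by rw [← h3]; exact ha
      simp only [mem_sdiff, mem_union, mem_univ, true_and] at ha hb ⊢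
      tauto
    · rw [Finset.card_sdiff_of_subset h1, p.1.2, ← hU1, c1, hs]; omega
  · intro R hR
    rw [Finset.mem_powersetCard] at hR
    have d1 : Disjoint R U1 := Finset.disjoint_of_subset_left hR.1
      (Finset.disjoint_of_subset_right Finset.subset_union_left Finset.sdiff_disjoint)
    have d2 : Disjoint R U2 := Finset.disjoint_of_subset_left hR.1
      (Finset.disjoint_of_subset_right Finset.subset_union_right Finset.sdiff_disjoint)
    refine Finset.mem_filter.2 ⟨Finset.mem_univ _, hC, Finset.subset_union_right,
      Finset.subset_union_right, ?_⟩
    simp only [← hU1, ← hU2]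
    rw [Finset.union_sdiff_cancel_right d1, Finset.union_sdiff_cancel_right d2]
  · intro p hp
    obtain ⟨_, h1, h2, h3⟩ := (Finset.mem_filter.1 hp).2
    refine Prod.ext (Subtype.ext ?_) (Subtype.ext ?_)
    · exact Finset.sdiff_union_of_subset h1
    · change p.1.1 \ U1 ∪ U2 = p.2.1
      rw [h3]; exact Finset.sdiff_union_of_subset h2
  · intro R hR
    rw [Finset.mem_powersetCard] at hR
    have d1 : Disjoint R U1 := Finset.disjoint_of_subset_left hR.1
      (Finset.disjoint_of_subset_right Finset.subset_union_left Finset.sdiff_disjoint)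
    exact Finset.union_sdiff_cancel_right d1

/-- Collision count. -/
theorem hx_collide (k n : ℕ) (hn : 0 < n) :
    ∑ C : Fin k → Fin n, hxInd (¬ Set.InjOn C (hxJ1 k ∪ hxJ2 k : Finset (Fin k))) ≤
      ((k : ℝ) ^ 2 / (2 * n)) * (Fintype.card (Fin k → Fin n) : ℝ) := by
  classical
  have hn' : (0 : ℝ) < n := by exact_mod_cast hn
  have pair : ∀ i j : Fin k, i ≠ j → ∑ C : Fin k → Fin n, hxInd (C i = C j) ≤
      (1 / n) * (Fintype.card (Fin k → Fin n) : ℝ) := by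
    intro i j hij
    have : ∑ C : Fin k → Fin n, hxInd (C i = C j) ≤ (1 / n) * ∑ C : Fin k → Fin n, (1 : ℝ) := by
      have : Nonempty (Fin n) := ⟨⟨0, hn⟩⟩
      have h := hx_indep i (fun _ : Fin k → Fin n => (1 : ℝ)) (fun H a => hxInd (a = H j)) (1 / n)
        (fun _ => zero_le_one) (fun _ _ => rfl)
        (fun H a b => by rw [Function.update_of_ne (Ne.symm hij)])
        (fun H => by
          rw [Finset.sum_eq_single (H j), hxInd_true rfl]
          · simp [hn'.ne']
          · intro b _ hb; exact hxInd_false hb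
          · simp)
      simpa using h
    simpa using this
  set Pr := (univ : Finset (Fin k × Fin k)).filter (fun p => p.1 < p.2) with hPr
  have step1 : ∀ C : Fin k → Fin n, hxInd (¬ Set.InjOn C (hxJ1 k ∪ hxJ2 k : Finset (Fin k))) ≤
      ∑ p ∈ Pr, hxInd (C p.1 = C p.2) := by
    intro C
    by_cases h : Set.InjOn C (hxJ1 k ∪ hxJ2 k : Finset (Fin k))
    · rw [hxInd_false (by simpa using h)]
      exact Finset.sum_nonneg fun _ _ => hxInd_nonneg _
    · rw [hxInd_true h]
      unfold Set.InjOn at h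
      push Not at h
      obtain ⟨i, _, j, _, hij, hne⟩ := h
      have hex : ∃ p ∈ Pr, C p.1 = C p.2 := by
        rcases lt_or_gt_of_ne hne with h | h
        · exact ⟨(i, j), by simp [hPr, h], hij⟩
        · exact ⟨(j, i), by simp [hPr, h], hij.symm⟩
      obtain ⟨p, hp, hpe⟩ := hex
      rw [← hxInd_true hpe]
      exact Finset.single_le_sum (f := fun p : Fin k × Fin k => hxInd (C p.1 = C p.2))
        (fun _ _ => hxInd_nonneg _) hp
  have hcard : (Pr.card : ℝ) ≤ (k : ℝ) ^ 2 / 2 := by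
    set Pr' := (univ : Finset (Fin k × Fin k)).filter (fun p => p.2 < p.1) with hPr'
    have e : Pr'.card = Pr.card := by
      refine Finset.card_bij' (fun p _ => p.swap) (fun p _ => p.swap) ?_ ?_ ?_ ?_ <;>
        simp [hPr, hPr']
    have hdis : Disjoint Pr Pr' := by
      rw [Finset.disjoint_left]; intro p h1 h2
      simp only [hPr, hPr', mem_filter] at h1 h2
      exact absurd h1.2 (not_lt.2 h2.2.le)
    have := Finset.card_le_univ (Pr ∪ Pr')
    rw [Finset.card_union_of_disjoint hdis, e] at this
    simp only [Fintype.card_prod, Fintype.card_fin] at this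
    have : ((Pr.card + Pr.card : ℕ) : ℝ) ≤ ((k * k : ℕ) : ℝ) := by exact_mod_cast this
    push_cast at this
    nlinarith
  calc _ ≤ ∑ C : Fin k → Fin n, ∑ p ∈ Pr, hxInd (C p.1 = C p.2) :=
        Finset.sum_le_sum fun C _ => step1 C
    _ = ∑ p ∈ Pr, ∑ C : Fin k → Fin n, hxInd (C p.1 = C p.2) := Finset.sum_comm
    _ ≤ ∑ p ∈ Pr, (1 / n) * (Fintype.card (Fin k → Fin n) : ℝ) := by
        refine Finset.sum_le_sum fun p hp => pair _ _ ?_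
        simp only [hPr, mem_filter] at hp
        exact hp.2.ne
    _ = Pr.card * ((1 / n) * (Fintype.card (Fin k → Fin n) : ℝ)) := by
        rw [Finset.sum_const, nsmul_eq_mul]
    _ ≤ ((k : ℝ) ^ 2 / 2) * ((1 / n) * (Fintype.card (Fin k → Fin n) : ℝ)) := by gcongr
    _ = _ := by field_simp

theorem hx_deg_prod {n : ℕ} {ι : Type*} (J : Finset ι) (f : ι → Fin n) :
    (∏ j ∈ J, (X (f j) : MvPolynomial (Fin n) ℝ)).totalDegree ≤ J.card := by
  refine (totalDegree_finsetProd _ _).trans ?_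
  simp

theorem hx_deg_prod2 {n : ℕ} {ι : Type*} (J : Finset ι) (f : ι → Fin n) :
    ((∏ j ∈ J, (X (f j) : MvPolynomial (Fin n) ℝ)) ^ 2).totalDegree ≤ 2 * J.card :=
  (totalDegree_pow _ _).trans (Nat.mul_le_mul_left _ (hx_deg_prod J f))

theorem PseudoExpectation.sq_prod {n d : ℕ} (E : PseudoExpectation n d) {ι : Type*}
    (J : Finset ι) (f : ι → Fin n) (g : MvPolynomial (Fin n) ℝ)
    (h : g.totalDegree + 2 * J.card ≤ d) :
    E.toFun ((∏ j ∈ J, X (f j)) ^ 2 * g) = E.toFun g := by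
  classical
  induction J using Finset.induction_on with
  | empty => simp
  | insert a J ha ih =>
    rw [Finset.card_insert_of_notMem ha] at h
    rw [Finset.prod_insert ha, mul_pow, mul_assoc, E.boolean]
    · exact ih (by omega)
    · have h1 := totalDegree_mul ((∏ j ∈ J, (X (f j) : MvPolynomial (Fin n) ℝ)) ^ 2) g
      have h2 := hx_deg_prod2 (n := n) J f
      omega

theorem PseudoExpectation.sq_prod_one {n d : ℕ} (E : PseudoExpectation n d) {ι : Type*}
    (J : Finset ι) (f : ι → Fin n) (h : 2 * J.card ≤ d) :
    E.toFun ((∏ j ∈ J, X (f j)) ^ 2) = 1 := by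
  have := E.sq_prod J f 1 (by simpa using h)
  rw [mul_one] at this
  rw [this, E.normalized]

theorem PseudoExpectation.abs_prod {n d : ℕ} (E : PseudoExpectation n d) {ι : Type*}
    (J : Finset ι) (f : ι → Fin n) (h : 2 * J.card ≤ d) :
    |E.toFun (∏ j ∈ J, X (f j))| ≤ 1 := by
  have h1 := E.sq_prod_one J f h
  set p := ∏ j ∈ J, (X (f j) : MvPolynomial (Fin n) ℝ) with hp
  have hdp : p.totalDegree ≤ J.card := hx_deg_prod J f
  have a1 := E.posSq (1 + p) (by
    have := totalDegree_add (1 : MvPolynomial (Fin n) ℝ) p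
    simp at this; omega)
  have a2 := E.posSq (1 - p) (by
    have := totalDegree_sub (1 : MvPolynomial (Fin n) ℝ) p
    simp at this; omega)
  have e1 : (1 + p) ^ 2 = 1 + (p + p) + p ^ 2 := by ring
  have e2 : (1 - p) ^ 2 = 1 - (p + p) + p ^ 2 := by ring
  rw [e1, map_add, map_add, map_add, h1, E.normalized] at a1
  rw [e2, map_add, map_sub, map_add, h1, E.normalized] at a2
  rw [abs_le]; constructor <;> linarith

/-- The monomial of a set. -/
noncomputable def hxMon {n : ℕ} (S : Finset (Fin n)) : MvPolynomial (Fin n) ℝ := ∏ i ∈ S, X i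

/-- The monomial of a tuple without the key. -/
noncomputable def hxY {k n : ℕ} (C : Fin k → Fin n) : MvPolynomial (Fin n) ℝ :=
  ∏ j ∈ hxJ1 k ∪ hxJ2 k, X (C j)

theorem hxMon_deg {n : ℕ} (S : Finset (Fin n)) : (hxMon S).totalDegree ≤ S.card :=
  hx_deg_prod S id

theorem hxY_deg {k n : ℕ} (C : Fin k → Fin n) :
    (hxY C).totalDegree ≤ (hxJ1 k).card + (hxJ2 k).card :=
  (hx_deg_prod _ _).trans (Finset.card_union_le _ _)

theorem hxY_key {k n : ℕ} [NeZero k] (C : Fin k → Fin n) : ∏ j, X (C j) = X (C 0) * hxY C := by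
  classical
  rw [hxJ_zero, Finset.prod_insert, hxY]
  simp [hxJ_zero1, hxJ_zero2]

theorem hxRel_mon {k n : ℕ} {C : Fin k → Fin n} {S T : Finset (Fin n)} (h : hxRel C S T) :
    hxMon S * hxMon T = hxMon (S \ (hxJ1 k).image C) ^ 2 * hxY C := by
  classical
  obtain ⟨hC, h1, h2, h3⟩ := h
  have e1 : hxMon S = hxMon (S \ (hxJ1 k).image C) * ∏ j ∈ hxJ1 k, X (C j) := by
    unfold hxMon
    rw [← Finset.prod_sdiff h1, Finset.prod_image (hC.mono (by simp))]
  have e2 : hxMon T = hxMon (T \ (hxJ2 k).image C) * ∏ j ∈ hxJ2 k, X (C j) := by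
    unfold hxMon
    rw [← Finset.prod_sdiff h2, Finset.prod_image (hC.mono (by simp))]
  rw [e1, e2, ← h3, hxY, Finset.prod_union (hxJ_disj k)]
  ring

/-- Moment matrix. -/
noncomputable def hxM {n d : ℕ} (E : PseudoExpectation n d) (s s' : ℕ) :
    Matrix (HxX n s s') (HxX n s s') ℝ :=
  fun x y => E.toFun ((hxMon x.1.1 * hxMon x.2.1) * (hxMon y.1.1 * hxMon y.2.1))

theorem hxV_deg {n s s' : ℕ} (x : HxX n s s') :
    (hxMon x.1.1 * hxMon x.2.1).totalDegree ≤ s + s' := by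
  refine (totalDegree_mul _ _).trans ?_
  have h1 := hxMon_deg x.1.1
  have h2 := hxMon_deg x.2.1
  rw [x.1.2] at h1; rw [x.2.2] at h2; omega

theorem hxM_symm {n d : ℕ} (E : PseudoExpectation n d) (s s' : ℕ) (x y : HxX n s s') :
    hxM E s s' x y = hxM E s s' y x := by unfold hxM; rw [mul_comm]

theorem hxM_psd {n d : ℕ} (E : PseudoExpectation n d) (s s' : ℕ) (h : 2 * (s + s') ≤ d) :
    (hxM E s s').PosSemidef := by
  refine Matrix.PosSemidef.of_dotProduct_mulVec_nonneg ?_ ?_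
  · ext x y
    simp only [Matrix.conjTranspose_apply, star_trivial]
    exact hxM_symm E s s' y x
  · intro v
    have hd : (∑ x, v x • (hxMon x.1.1 * hxMon x.2.1 : MvPolynomial (Fin n) ℝ) :
        MvPolynomial (Fin n) ℝ).totalDegree ≤ s + s' := by
      refine (totalDegree_finsetSum _ _).trans (Finset.sup_le fun x _ => ?_)
      exact (totalDegree_smul_le _ _).trans (hxV_deg x)
    have := E.posSq (∑ x : HxX n s s', v x • (hxMon x.1.1 * hxMon x.2.1)) (by omega)
    have e : E.toFun ((∑ x : HxX n s s', v x • (hxMon x.1.1 * hxMon x.2.1)) ^ 2) =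
        star v ⬝ᵥ (hxM E s s').mulVec v := by
      rw [pow_two, Finset.sum_mul_sum, map_sum]
      simp only [dotProduct, Matrix.mulVec, star_trivial]
      refine Finset.sum_congr rfl fun x _ => ?_
      rw [map_sum, Finset.mul_sum]
      refine Finset.sum_congr rfl fun y _ => ?_
      rw [smul_mul_smul_comm, map_smul, smul_eq_mul, hxM]
      ring
    rwa [e] at this

theorem hxM_diag {n d : ℕ} (E : PseudoExpectation n d) (s s' : ℕ) (h : 2 * (s + s') ≤ d)
    (x : HxX n s s') : hxM E s s' x x = 1 := by
  unfold hxM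
  have e : (hxMon x.1.1 * hxMon x.2.1) * (hxMon x.1.1 * hxMon x.2.1) =
    (∏ i ∈ x.1.1, X (id i)) ^ 2 * (∏ i ∈ x.2.1, X (id i) : MvPolynomial (Fin n) ℝ) ^ 2 := by
    simp only [hxMon, id]; ring
  rw [e, E.sq_prod, E.sq_prod_one]
  · rw [x.2.2]; omega
  · have := hx_deg_prod2 (n := n) x.2.1 id
    rw [x.2.2] at this; rw [x.1.2]; omega

theorem hxM_step {k n d : ℕ} [NeZero k] (E : PseudoExpectation n d) (s s' b : ℕ)
    (hs : s = b + (hxJ1 k).card) (hs' : s' = b + (hxJ2 k).card)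
    (h : 2 * (s + s') ≤ d) (C C' : Fin k → Fin n) (x y : HxX n s s')
    (hst : (hxK k n s s').step C C' x y) :
    hxM E s s' x y = E.toFun (hxY C * hxY C') := by
  classical
  unfold hxM
  obtain ⟨h1, h2⟩ := hst
  have e : (hxMon x.1.1 * hxMon x.2.1) * (hxMon y.1.1 * hxMon y.2.1) =
      (hxMon x.1.1 * hxMon y.2.1) * (hxMon y.1.1 * hxMon x.2.1) := by ring
  rw [e, hxRel_mon h1, hxRel_mon h2]
  set R := x.1.1 \ (hxJ1 k).image C
  set R' := y.1.1 \ (hxJ1 k).image C'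
  have cR : R.card = b := by
    rw [Finset.card_sdiff_of_subset h1.2.1, x.1.2, Finset.card_image_of_injOn
      (h1.1.mono (by simp)), hs]; omega
  have cR' : R'.card = b := by
    rw [Finset.card_sdiff_of_subset h2.2.1, y.1.2, Finset.card_image_of_injOn
      (h2.1.mono (by simp)), hs]; omega
  have e2 : hxMon R ^ 2 * hxY C * (hxMon R' ^ 2 * hxY C') =
      (∏ i ∈ R, X (id i)) ^ 2 * ((∏ i ∈ R', X (id i)) ^ 2 * (hxY C * hxY C')) := by
    simp only [hxMon, id]; ring
  have d1 : (hxY C * hxY C').totalDegree ≤ 2 * ((hxJ1 k).card + (hxJ2 k).card) := by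
    refine (totalDegree_mul _ _).trans ?_
    have := hxY_deg C; have := hxY_deg C'; omega
  have d2 : ((∏ i ∈ R', X (id i)) ^ 2 * (hxY C * hxY C')).totalDegree ≤
      2 * b + 2 * ((hxJ1 k).card + (hxJ2 k).card) := by
    refine (totalDegree_mul _ _).trans ?_
    have := hx_deg_prod2 (n := n) R' id
    rw [cR'] at this; omega
  rw [e2, E.sq_prod, E.sq_prod]
  · rw [cR']; omega
  · rw [cR]; omega

/-- Sum over all transitions of a pair of tuples. -/
theorem hxK_step_sum {k n d : ℕ} [NeZero k] (E : PseudoExpectation n d) (s s' b : ℕ)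
    (hs : s = b + (hxJ1 k).card) (hs' : s' = b + (hxJ2 k).card)
    (h : 2 * (s + s') ≤ d) (C C' : Fin k → Fin n) :
    ∑ x, ∑ y, hxInd ((hxK k n s s').step C C' x y) * hxM E s s' x y =
      hxInd (Set.InjOn C (hxJ1 k ∪ hxJ2 k : Finset (Fin k)) ∧
        Set.InjOn C' (hxJ1 k ∪ hxJ2 k : Finset (Fin k))) *
      (((n - ((hxJ1 k).card + (hxJ2 k).card)).choose b : ℝ) ^ 2 * E.toFun (hxY C * hxY C')) := by
  classical
  by_cases hinj : Set.InjOn C (hxJ1 k ∪ hxJ2 k : Finset (Fin k)) ∧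
        Set.InjOn C' (hxJ1 k ∪ hxJ2 k : Finset (Fin k))
  swap
  · rw [hxInd_false hinj, zero_mul]
    refine Finset.sum_eq_zero fun x _ => Finset.sum_eq_zero fun y _ => ?_
    rw [hxInd_false, zero_mul]
    exact fun hst => hinj ⟨hst.1.1, hst.2.1⟩
  rw [hxInd_true hinj, one_mul]
  have e1 : ∀ x y, hxInd ((hxK k n s s').step C C' x y) * hxM E s s' x y =
      (hxInd (hxRel C x.1.1 y.2.1) * hxInd (hxRel C' y.1.1 x.2.1)) * E.toFun (hxY C * hxY C') := by
    intro x y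
    by_cases hst : (hxK k n s s').step C C' x y
    · rw [hxM_step E s s' b hs hs' h C C' x y hst]
      congr 1
      exact hxInd_and _ _
    · have : hxInd (hxRel C x.1.1 y.2.1) * hxInd (hxRel C' y.1.1 x.2.1) = 0 := by
        rw [← hxInd_and]; exact hxInd_false hst
      rw [this, hxInd_false hst]; ring
  simp only [e1, ← Finset.sum_mul]
  congr 1
  have c1 := hxRel_count (b := b) (s := s) (s' := s') C hinj.1 hs hs'
  have c2 := hxRel_count (b := b) (s := s) (s' := s') C' hinj.2 hs hs'
  rw [pow_two]
  nth_rewrite 1 [← c1]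
  rw [← c2]
  simp only [Fintype.sum_prod_type, Finset.sum_mul_sum]
  refine Finset.sum_congr rfl fun S _ => ?_
  -- reorder T, S', T'
  calc ∑ T : {T : Finset (Fin n) // T.card = s'}, ∑ S' : {S : Finset (Fin n) // S.card = s},
        ∑ T' : {T : Finset (Fin n) // T.card = s'},
        hxInd (hxRel C S.1 T'.1) * hxInd (hxRel C' S'.1 T.1)
      = ∑ S' : {S : Finset (Fin n) // S.card = s}, ∑ T : {T : Finset (Fin n) // T.card = s'},
        ∑ T' : {T : Finset (Fin n) // T.card = s'},
        hxInd (hxRel C S.1 T'.1) * hxInd (hxRel C' S'.1 T.1) := Finset.sum_comm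
    _ = _ := Finset.sum_congr rfl fun S' _ => Finset.sum_comm

/-- Injectivity away from the key. -/
def hxInj {k n : ℕ} (C : Fin k → Fin n) : Prop :=
  Set.InjOn C (hxJ1 k ∪ hxJ2 k : Finset (Fin k))

theorem hx_card_J (k : ℕ) (hk : 2 ≤ k) : (hxJ1 k).card + (hxJ2 k).card = k - 1 := by
  rw [hxJ1_card k hk, hxJ2_card k hk]; omega

/-- Bucketed Cauchy-Schwarz. -/
theorem hx_bucket {k n m d : ℕ} [NeZero k] (hk : 2 ≤ k) (hn : 0 < n) (E : PseudoExpectation n d)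
    (hd : 2 * k ≤ d) (H : Fin m → Fin k → Fin n) (w : Fin m → ℝ) :
    (∑ i, w i * E.toFun (X (H i 0) * hxY (H i))) ^ 2 ≤
      n * ∑ i, ∑ j, hxInd (H i 0 = H j 0) * (w i * w j * E.toFun (hxY (H i) * hxY (H j))) := by
  classical
  have hn' : (0 : ℝ) < n := by exact_mod_cast hn
  set Y := ∑ i, w i * E.toFun (X (H i 0) * hxY (H i)) with hY
  set Q := ∑ i, ∑ j, hxInd (H i 0 = H j 0) * (w i * w j * E.toFun (hxY (H i) * hxY (H j))) with hQ
  set g : Fin n → MvPolynomial (Fin n) ℝ := fun u =>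
    ∑ i, (hxInd (H i 0 = u) * w i) • hxY (H i) with hg
  have hgd : ∀ u, (g u).totalDegree ≤ k := by
    intro u
    refine (totalDegree_finsetSum _ _).trans (Finset.sup_le fun i _ => ?_)
    refine (totalDegree_smul_le _ _).trans ((hxY_deg _).trans ?_)
    rw [hx_card_J k hk]; omega
  have h1 : ∑ u, E.toFun (X u * g u) = Y := by
    simp only [hg, Finset.mul_sum, map_sum]
    rw [Finset.sum_comm]
    refine Finset.sum_congr rfl fun i _ => ?_
    rw [Finset.sum_eq_single (H i 0)]
    · rw [hxInd_true rfl, one_mul, mul_smul_comm, map_smul, smul_eq_mul]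
    · intro u _ hu
      rw [hxInd_false (Ne.symm hu)]; simp
    · simp
  have h2 : ∑ u, E.toFun (g u ^ 2) = Q := by
    simp only [hg, pow_two, Finset.sum_mul_sum, map_sum]
    rw [Finset.sum_comm]
    refine Finset.sum_congr rfl fun i _ => ?_
    rw [Finset.sum_comm]
    refine Finset.sum_congr rfl fun j _ => ?_
    rw [Finset.sum_eq_single (H j 0)]
    · rw [hxInd_true (rfl : H j 0 = H j 0), smul_mul_smul_comm, map_smul, smul_eq_mul]
      ring
    · intro u _ hu
      rw [hxInd_false (Ne.symm hu)]; simp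
    · simp
  have h3 : ∀ z : ℝ, 0 ≤ n * z ^ 2 - 2 * z * Y + Q := by
    intro z
    have : ∀ u, 0 ≤ z ^ 2 - 2 * z * E.toFun (X u * g u) + E.toFun (g u ^ 2) := by
      intro u
      have a := E.posSq (z • X u - g u) (by
        have a1 := totalDegree_sub (z • X u) (g u)
        have a2 := totalDegree_smul_le z (X u : MvPolynomial (Fin n) ℝ)
        have a3 : (X u : MvPolynomial (Fin n) ℝ).totalDegree = 1 := totalDegree_X u
        have a4 := hgd u
        have : (z • X u - g u).totalDegree ≤ k := a1.trans (max_le (by omega) a4)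
        omega)
      have e : (z • X u - g u) ^ 2 = z ^ 2 • (X u) ^ 2 - (2 * z) • (X u * g u) + (g u) ^ 2 := by
        simp only [MvPolynomial.smul_eq_C_mul, map_pow, map_mul]
        have : (C (2 : ℝ) : MvPolynomial (Fin n) ℝ) = 2 := map_ofNat C 2
        rw [this]; ring
      rw [e, map_add, map_sub, map_smul, map_smul] at a
      have b := E.boolean u 1 (by simp; omega)
      rw [mul_one, E.normalized] at b
      rw [b] at a
      simpa using a
    have := Finset.sum_nonneg fun u (_ : u ∈ univ) => this u
    rw [Finset.sum_add_distrib, Finset.sum_sub_distrib, ← Finset.mul_sum, h1, h2] at this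
    simpa using this
  have := h3 (Y / n)
  have e : n * (Y / n) ^ 2 - 2 * (Y / n) * Y + Q = Q - Y ^ 2 / n := by field_simp; ring
  rw [e] at this
  have : Y ^ 2 / n ≤ Q := by linarith
  rw [div_le_iff₀ hn'] at this
  linarith

theorem hxY_sq {k n d : ℕ} (hk : 2 ≤ k) (E : PseudoExpectation n d) (hd : 2 * k ≤ d)
    (C : Fin k → Fin n) : E.toFun (hxY C * hxY C) = 1 := by
  rw [← pow_two]
  refine E.sq_prod_one _ _ ?_
  have := Finset.card_union_le (hxJ1 k) (hxJ2 k)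
  rw [hx_card_J k hk] at this; omega

/-- Number of bad transitions. -/
noncomputable def hxBad {k n m : ℕ} [NeZero k] (s s' t : ℕ) (H : Fin m → Fin k → Fin n) : ℝ :=
  ∑ e : Fin m × Fin m, ∑ x, ∑ y,
      hxInd ((e.1 ≠ e.2 ∧ (hxK k n s s').key (H e.1) = (hxK k n s s').key (H e.2) ∧
        (hxK k n s s').step (H e.1) (H e.2) x y) ∧ ¬ (hxK k n s s').good t H univ x)

theorem hxBad_swap {k n m : ℕ} [NeZero k] (s s' t : ℕ) (H : Fin m → Fin k → Fin n) :
    ∑ e : Fin m × Fin m, ∑ x, ∑ y,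
      hxInd ((e.1 ≠ e.2 ∧ (hxK k n s s').key (H e.1) = (hxK k n s s').key (H e.2) ∧
        (hxK k n s s').step (H e.1) (H e.2) x y) ∧ ¬ (hxK k n s s').good t H univ y) =
    hxBad s s' t H := by
  unfold hxBad
  rw [← Equiv.sum_comp (Equiv.prodComm (Fin m) (Fin m))]
  refine Finset.sum_congr rfl fun e _ => ?_
  rw [Finset.sum_comm]
  refine Finset.sum_congr rfl fun x _ => Finset.sum_congr rfl fun y _ => ?_
  refine hxInd_congr ?_
  simp only [Equiv.prodComm_apply, Prod.fst_swap, Prod.snd_swap]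
  rw [hxK_symm]
  constructor
  · rintro ⟨⟨a, b, c⟩, d⟩; exact ⟨⟨Ne.symm a, b.symm, c⟩, d⟩
  · rintro ⟨⟨a, b, c⟩, d⟩; exact ⟨⟨Ne.symm a, b.symm, c⟩, d⟩

theorem hxA_symm {k n m : ℕ} [NeZero k] (s s' t : ℕ) (H : Fin m → Fin k → Fin n)
    (τ : Fin m → Bool) :
    ((hxK k n s s').A t H τ).transpose = (hxK k n s s').A t H τ := by
  ext x y
  simp only [Matrix.transpose_apply, HxSys.A]
  rw [← Equiv.sum_comp (Equiv.prodComm (Fin m) (Fin m))]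
  refine Finset.sum_congr rfl fun e _ => ?_
  simp only [Equiv.prodComm_apply, Prod.fst_swap, Prod.snd_swap]
  rw [mul_comm (hxSg (τ e.2))]
  congr 1
  unfold HxSys.c
  refine hxInd_congr ?_
  simp only [Prod.fst_swap, Prod.snd_swap]
  rw [hxK_symm]
  constructor
  · rintro ⟨⟨a, b, c⟩, d, f⟩; exact ⟨⟨Ne.symm a, b.symm, c⟩, f, d⟩
  · rintro ⟨⟨a, b, c⟩, d, f⟩; exact ⟨⟨Ne.symm a, b.symm, c⟩, f, d⟩

theorem hx_det {k n m d : ℕ} [NeZero k] (hk : 2 ≤ k) (hn : 0 < n) (E : PseudoExpectation n d)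
    (s s' b t : ℕ) (hs : s = b + (hxJ1 k).card) (hs' : s' = b + (hxJ2 k).card)
    (h : 2 * (s + s') ≤ d) (hd : 2 * k ≤ d)
    (H : Fin m → Fin k → Fin n) (τ : Fin m → Bool) :
    ((n - ((hxJ1 k).card + (hxJ2 k).card)).choose b : ℝ) ^ 2 *
      (∑ i, (hxSg (τ i) * hxInd (hxInj (H i))) * E.toFun (X (H i 0) * hxY (H i))) ^ 2 ≤
    n * (((n - ((hxJ1 k).card + (hxJ2 k).card)).choose b : ℝ) ^ 2 * m +
      |((hxK k n s s').A t H τ * hxM E s s').trace| + 2 * hxBad s s' t H) := by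
  classical
  set E2 := ((n - ((hxJ1 k).card + (hxJ2 k).card)).choose b : ℝ) ^ 2 with hE2
  have hE0 : 0 ≤ E2 := by positivity
  set w : Fin m → ℝ := fun i => hxSg (τ i) * hxInd (hxInj (H i)) with hw
  set K := hxK k n s s' with hK
  set M := hxM E s s' with hM
  have hM1 : ∀ x y, |M x y| ≤ 1 := hx_entry M (hxM_psd E s s' h) (hxM_diag E s s' h)
  have B := hx_bucket hk hn E hd H w
  set R := ∑ e : Fin m × Fin m, hxInd (e.1 ≠ e.2) * (hxInd (H e.1 0 = H e.2 0) *
    (w e.1 * w e.2 * E.toFun (hxY (H e.1) * hxY (H e.2)))) with hR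
  have s1 : ∑ i, ∑ j, hxInd (H i 0 = H j 0) * (w i * w j * E.toFun (hxY (H i) * hxY (H j))) ≤
      m + R := by
    rw [hR, Fintype.sum_prod_type]
    have : (m : ℝ) = ∑ i : Fin m, (1 : ℝ) := by simp
    rw [this, ← Finset.sum_add_distrib]
    refine Finset.sum_le_sum fun i _ => ?_
    have : (1 : ℝ) = ∑ j : Fin m, if i = j then (1 : ℝ) else 0 := by simp
    rw [this, ← Finset.sum_add_distrib]
    refine Finset.sum_le_sum fun j _ => ?_
    by_cases hij : i = j
    · subst hij
      rw [hxInd_true rfl, hxY_sq hk E hd, hxInd_false (by simp)]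
      simp only [if_true, hw]
      have a := hxSg_sq (τ i)
      have b1 := hxInd_nonneg (hxInj (H i))
      have b2 := hxInd_le_one (hxInj (H i))
      calc _ = (hxSg (τ i) * hxSg (τ i)) * (hxInd (hxInj (H i)) * hxInd (hxInj (H i))) := by ring
        _ ≤ _ := by rw [a]; nlinarith
    · rw [hxInd_true (show i ≠ j from hij)]; simp [hij]
  set cond : Fin m × Fin m → HxX n s s' → HxX n s s' → Prop := fun e x y =>
    e.1 ≠ e.2 ∧ K.key (H e.1) = K.key (H e.2) ∧ K.step (H e.1) (H e.2) x y with hcond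
  have s2 : E2 * R = ∑ e : Fin m × Fin m, ∑ x, ∑ y,
      (hxSg (τ e.1) * hxSg (τ e.2)) * hxInd (cond e x y) * M x y := by
    rw [hR, Finset.mul_sum]
    refine Finset.sum_congr rfl fun e _ => ?_
    have a := hxK_step_sum E s s' b hs hs' h (H e.1) (H e.2)
    have e1 : ∀ x y, (hxSg (τ e.1) * hxSg (τ e.2)) * hxInd (cond e x y) * M x y =
        ((hxSg (τ e.1) * hxSg (τ e.2)) * (hxInd (e.1 ≠ e.2) * hxInd (H e.1 0 = H e.2 0))) *
          (hxInd (K.step (H e.1) (H e.2) x y) * M x y) := by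
      intro x y
      have : hxInd (cond e x y) = hxInd (e.1 ≠ e.2) * (hxInd (H e.1 0 = H e.2 0) *
          hxInd (K.step (H e.1) (H e.2) x y)) := by
        rw [← hxInd_and, ← hxInd_and]; rfl
      rw [this]; ring
    simp only [e1, ← Finset.mul_sum]
    rw [a, hxInd_and]
    simp only [hw, hxInj]
    ring
  have s3 : (K.A t H τ * M).trace = ∑ e : Fin m × Fin m, ∑ x, ∑ y,
      (hxSg (τ e.1) * hxSg (τ e.2)) * K.c t H e x y * M x y := by
    have : (K.A t H τ * M).trace = ∑ x, ∑ y, ∑ e : Fin m × Fin m,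
        (hxSg (τ e.1) * hxSg (τ e.2)) * K.c t H e x y * M x y := by
      simp only [Matrix.trace, Matrix.diag, Matrix.mul_apply, HxSys.A, Finset.sum_mul]
      refine Finset.sum_congr rfl fun x _ => Finset.sum_congr rfl fun y _ =>
        Finset.sum_congr rfl fun e _ => ?_
      rw [hM, hxM_symm E s s' y x]
    rw [this, Finset.sum_comm' (t' := univ) (s' := fun _ => univ) (by simp)]
    rw [Finset.sum_comm]
    rw [Finset.sum_congr rfl fun x _ => Finset.sum_comm]
    rw [Finset.sum_comm]
  have s4 : E2 * R - (K.A t H τ * M).trace ≤ hxBad s s' t H + hxBad s s' t H := by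
    nth_rewrite 2 [← hxBad_swap]
    rw [s2, s3]
    unfold hxBad
    simp only [← Finset.sum_sub_distrib, ← Finset.sum_add_distrib]
    refine Finset.sum_le_sum fun e _ => Finset.sum_le_sum fun x _ => Finset.sum_le_sum fun y _ => ?_
    have hb1 := hxInd_nonneg (cond e x y ∧ ¬ K.good t H univ x)
    have hb2 := hxInd_nonneg (cond e x y ∧ ¬ K.good t H univ y)
    change _ ≤ hxInd (cond e x y ∧ ¬ K.good t H univ x) + hxInd (cond e x y ∧ ¬ K.good t H univ y)
    have hc : K.c t H e x y = hxInd (cond e x y ∧ K.good t H univ x ∧ K.good t H univ y) := rfl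
    rw [hc]
    have hle : hxSg (τ e.1) * hxSg (τ e.2) * M x y ≤ 1 := by
      refine (le_abs_self _).trans ?_
      rw [abs_mul, abs_mul, hxSg_abs, hxSg_abs]
      simpa using hM1 x y
    by_cases c0 : cond e x y
    · by_cases g1 : K.good t H univ x
      · by_cases g2 : K.good t H univ y
        · rw [hxInd_true c0, hxInd_true (p := _ ∧ _ ∧ _) ⟨c0, g1, g2⟩]; linarith
        · rw [hxInd_true c0, hxInd_false (p := _ ∧ _ ∧ _) (by tauto),
            hxInd_true (p := _ ∧ ¬ K.good t H univ y) ⟨c0, g2⟩]; linarith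
      · rw [hxInd_true c0, hxInd_false (p := _ ∧ _ ∧ _) (by tauto),
            hxInd_true (p := _ ∧ ¬ K.good t H univ x) ⟨c0, g1⟩]; linarith
    · rw [hxInd_false c0, hxInd_false (p := _ ∧ _ ∧ _) (by tauto)]; simp; linarith
  have hn' : (0 : ℝ) ≤ n := by positivity
  calc E2 * (∑ i, w i * E.toFun (X (H i 0) * hxY (H i))) ^ 2
      ≤ E2 * (n * (m + R)) := by
        refine mul_le_mul_of_nonneg_left (B.trans ?_) hE0
        exact mul_le_mul_of_nonneg_left s1 hn'
    _ = n * (E2 * m + E2 * R) := by ring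
    _ ≤ _ := by
        refine mul_le_mul_of_nonneg_left ?_ hn'
        have := le_abs_self (K.A t H τ * M).trace
        linarith

theorem hx_final_det {k n m d : ℕ} [NeZero k] (hm : 0 < m) (E : PseudoExpectation n d)
    (hd : 2 * k ≤ d) (H : Fin m → Fin k → Fin n) (τ : Fin m → Bool) (A B : ℝ)
    (hA : |∑ i, (hxSg (τ i) * hxInd (hxInj (H i))) * E.toFun (X (H i 0) * hxY (H i))| ≤ A * m)
    (hB : ∑ i, hxInd (¬ hxInj (H i)) ≤ B * m) :
    |E.toFun (MvPolynomial.C ((m : ℝ)⁻¹) *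
              ∑ i : Fin m, MvPolynomial.C (if τ i then (1 : ℝ) else -1) *
                ∏ j : Fin k, X (H i j))| ≤ A + B := by
  have hm' : (0 : ℝ) < m := by exact_mod_cast hm
  rw [← MvPolynomial.smul_eq_C_mul, map_smul, smul_eq_mul, map_sum]
  have e : ∑ i : Fin m, E.toFun (MvPolynomial.C (if τ i then (1 : ℝ) else -1) *
      ∏ j : Fin k, X (H i j)) =
      ∑ i, (hxSg (τ i) * hxInd (hxInj (H i))) * E.toFun (X (H i 0) * hxY (H i)) +
      ∑ i, (hxSg (τ i) * hxInd (¬ hxInj (H i))) * E.toFun (X (H i 0) * hxY (H i)) := by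
    rw [← Finset.sum_add_distrib]
    refine Finset.sum_congr rfl fun i _ => ?_
    rw [← MvPolynomial.smul_eq_C_mul, map_smul, smul_eq_mul, hxY_key]
    change hxSg (τ i) * _ = _
    by_cases hi : hxInj (H i)
    · rw [hxInd_true hi, hxInd_false (by simpa using hi)]; ring
    · rw [hxInd_true hi, hxInd_false hi]; ring
  rw [e, abs_mul, abs_of_pos (inv_pos.2 hm'), inv_mul_le_iff₀ hm']
  refine (abs_add_le _ _).trans ?_
  have h2 : |∑ i, (hxSg (τ i) * hxInd (¬ hxInj (H i))) * E.toFun (X (H i 0) * hxY (H i))| ≤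
      B * m := by
    refine (Finset.abs_sum_le_sum_abs _ _).trans (le_trans (Finset.sum_le_sum fun i _ => ?_) hB)
    rw [abs_mul, abs_mul, hxSg_abs, one_mul, abs_of_nonneg (hxInd_nonneg _), ← hxY_key]
    have := E.abs_prod (univ : Finset (Fin k)) (H i) (by simpa using hd)
    exact mul_le_of_le_one_right (hxInd_nonneg _) this
  linarith

theorem hx_markov {α : Type*} [Fintype α] (f : α → ℝ) (hf : ∀ a, 0 ≤ f a) (c n : ℝ) (hc : 0 ≤ c)
    (hn : 0 < n) (h : ∑ a, f a ≤ c * (Fintype.card α : ℝ)) :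
    ∑ a, hxInd (n * c < f a) ≤ (1 / n) * (Fintype.card α : ℝ) := by
  classical
  rcases hc.eq_or_lt with hc0 | hc0
  · have h0 : ∀ a, f a = 0 := by
      intro a
      have h1 := Finset.single_le_sum (f := f) (fun a _ => hf a) (Finset.mem_univ a)
      rw [← hc0, zero_mul] at h
      exact le_antisymm (h1.trans h) (hf a)
    rw [Finset.sum_eq_zero]
    · positivity
    · intro a _
      refine hxInd_false ?_
      rw [h0, ← hc0]; simp
  · have : (n * c) * ∑ a, hxInd (n * c < f a) ≤ c * (Fintype.card α : ℝ) := by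
      refine le_trans ?_ h
      rw [Finset.mul_sum]
      refine Finset.sum_le_sum fun a _ => ?_
      by_cases ha : n * c < f a
      · rw [hxInd_true ha]; linarith
      · rw [hxInd_false ha]; simpa using hf a
    rw [one_div, inv_mul_eq_div, le_div_iff₀ hn]
    have h2 : c * ((∑ a, hxInd (n * c < f a)) * n) ≤ c * (Fintype.card α : ℝ) := by linarith
    exact le_of_mul_le_mul_left h2 hc0

theorem hx_poisson (x : ℝ) (hx : 0 ≤ x) (q : ℕ) :
    x ^ q / (q.factorial : ℝ) ≤ Real.exp (2.7182818286 * x - q) := by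
  have h := Real.pow_div_factorial_le_exp (x := Real.exp 1 * x) (by positivity) q
  have h1 : (Real.exp 1 * x) ^ q / (q.factorial : ℝ) = Real.exp q * (x ^ q / q.factorial) := by
    rw [mul_pow, ← Real.exp_nat_mul]; simp; ring
  rw [h1] at h
  have h2 : x ^ q / (q.factorial : ℝ) ≤ Real.exp (Real.exp 1 * x - q) := by
    rw [Real.exp_sub, le_div_iff₀ (Real.exp_pos _)]; linarith
  refine h2.trans (Real.exp_le_exp.2 ?_)
  have := Real.exp_one_lt_d9.le
  nlinarith

theorem hx_choose1 (n ℓ b a : ℕ) (hn : 0 < n) (hb : ℓ ≤ 4 * (b + 1)) :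
    (n.choose (b + a) : ℝ) * ((ℓ : ℝ) / n) ^ a ≤ 4 ^ a * n.choose b := by
  induction a with
  | zero => simp
  | succ a ih =>
    have hn' : (0 : ℝ) < n := by exact_mod_cast hn
    have hr0 : (0 : ℝ) ≤ (ℓ : ℝ) / n := by positivity
    have h1 : n.choose (b + a + 1) * (b + a + 1) = n.choose (b + a) * (n - (b + a)) :=
      Nat.choose_succ_right_eq n (b + a)
    have h2 : n.choose (b + a + 1) * (b + 1) ≤ n.choose (b + a) * n := by
      calc _ ≤ n.choose (b + a + 1) * (b + a + 1) := Nat.mul_le_mul_left _ (by omega)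
        _ = _ := h1
        _ ≤ _ := Nat.mul_le_mul_left _ (by omega)
    have h3 : n.choose (b + a + 1) * ℓ ≤ 4 * (n.choose (b + a) * n) := by
      calc _ ≤ n.choose (b + a + 1) * (4 * (b + 1)) := Nat.mul_le_mul_left _ hb
        _ = 4 * (n.choose (b + a + 1) * (b + 1)) := by ring
        _ ≤ _ := Nat.mul_le_mul_left _ h2
    have h4 : (n.choose (b + a + 1) : ℝ) * ℓ ≤ 4 * (n.choose (b + a) * n) := by exact_mod_cast h3
    have h5 : (n.choose (b + a + 1) : ℝ) * (ℓ / n) ≤ 4 * n.choose (b + a) := by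
      rw [← mul_div_assoc, div_le_iff₀ hn']; linarith
    calc (n.choose (b + (a + 1)) : ℝ) * ((ℓ : ℝ) / n) ^ (a + 1)
        = (n.choose (b + a + 1) * (ℓ / n)) * ((ℓ : ℝ) / n) ^ a := by rw [← add_assoc]; ring
      _ ≤ (4 * n.choose (b + a)) * ((ℓ : ℝ) / n) ^ a := by gcongr
      _ = 4 * (n.choose (b + a) * ((ℓ : ℝ) / n) ^ a) := by ring
      _ ≤ 4 * (4 ^ a * n.choose b) := by gcongr
      _ = _ := by ring

theorem hx_choose2 (n b j : ℕ) (h : 2 * b + j ≤ n) :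
    (n.choose b : ℝ) ≤ 2 ^ j * (n - j).choose b := by
  induction j with
  | zero => simp
  | succ j ih =>
    have i1 := ih (by omega)
    obtain ⟨p, hp⟩ : ∃ p, n - j = p + 1 := ⟨n - j - 1, by omega⟩
    have hp2 : n - (j + 1) = p := by omega
    rw [hp] at i1
    rw [hp2]
    have h1 : p.choose b * (p + 1) = (p + 1).choose b * (p + 1 - b) := by
      have := Nat.choose_mul_succ_eq p b
      linarith
    have h2 : (p + 1).choose b * (p + 1) ≤ 2 * (p.choose b * (p + 1)) := by
      rw [h1]
      calc _ ≤ (p + 1).choose b * (2 * (p + 1 - b)) := Nat.mul_le_mul_left _ (by omega)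
        _ = _ := by ring
    have h3 : (p + 1).choose b ≤ 2 * p.choose b := by
      have : (p + 1).choose b * (p + 1) ≤ (2 * p.choose b) * (p + 1) := by linarith
      exact Nat.le_of_mul_le_mul_right this (by omega)
    have h4 : ((p + 1).choose b : ℝ) ≤ 2 * p.choose b := by exact_mod_cast h3
    calc (n.choose b : ℝ) ≤ 2 ^ j * (p + 1).choose b := i1
      _ ≤ 2 ^ j * (2 * p.choose b) := by gcongr
      _ = _ := by ring

theorem hx_card_X (n s s' : ℕ) : Fintype.card (HxX n s s') = n.choose s * n.choose s' := by
  rw [Fintype.card_prod]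
  simp [Fintype.card_finset_len]

theorem hx_card_bound (n k ℓ b a1 a2 : ℕ) (hn : 0 < n) (hb : ℓ ≤ 4 * (b + 1))
    (hk : a1 + a2 ≤ k) (h : 2 * b + (a1 + a2) ≤ n) :
    (Fintype.card (HxX n (b + a1) (b + a2)) : ℝ) * ((ℓ : ℝ) / n) ^ (a1 + a2) ≤
      16 ^ k * ((n - (a1 + a2)).choose b : ℝ) ^ 2 := by
  rw [hx_card_X]
  have h1 := hx_choose1 n ℓ b a1 hn hb
  have h2 := hx_choose1 n ℓ b a2 hn hb
  have h3 := hx_choose2 n b (a1 + a2) h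
  push_cast
  calc (n.choose (b + a1) : ℝ) * n.choose (b + a2) * ((ℓ : ℝ) / n) ^ (a1 + a2)
      = (n.choose (b + a1) * ((ℓ : ℝ) / n) ^ a1) * (n.choose (b + a2) * ((ℓ : ℝ) / n) ^ a2) := by
        rw [pow_add]; ring
    _ ≤ (4 ^ a1 * n.choose b) * (4 ^ a2 * n.choose b) := by gcongr
    _ = 4 ^ (a1 + a2) * (n.choose b : ℝ) ^ 2 := by rw [pow_add]; ring
    _ ≤ 4 ^ (a1 + a2) * (2 ^ (a1 + a2) * ((n - (a1 + a2)).choose b : ℝ)) ^ 2 := by gcongr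
    _ = 16 ^ (a1 + a2) * ((n - (a1 + a2)).choose b : ℝ) ^ 2 := by
        have : (16 : ℝ) = 4 * (2 * 2) := by norm_num
        rw [this, mul_pow, mul_pow, mul_pow]; ring
    _ ≤ _ := by
        gcongr
        norm_num

/-- Properties of the density parameter. -/
theorem hx_L_props (n m k ℓ : ℕ) (a δ : ℝ) (hn : 0 < n) (hm : 0 < m) (hℓ : 0 < ℓ) (hk : 2 ≤ k)
    (hδ : 0 < δ) (hℓn : ℓ ≤ n) (hlog : 1 ≤ Real.log n)
    (h : (m : ℝ) ≥ (2 : ℝ) ^ (a * (k : ℝ)) / δ ^ 4 *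
        ((n : ℝ) / (ℓ : ℝ)) ^ ((k : ℝ) / 2 - 1) * ((n : ℝ) * Real.log n)) :
    ∃ L : ℝ, 0 < L ∧ (2 : ℝ) ^ (a * (k : ℝ)) * Real.log n ≤ L * δ ^ 4 ∧
      (2 : ℝ) ^ (a * (k : ℝ)) * Real.log n * n ≤ m * δ ^ 4 ∧
      m * (((ℓ : ℝ) / n) ^ (k / 2) / n) ≤ L ∧
      m * (((ℓ : ℝ) / n) ^ (k - 1 - k / 2) / n) ≤ L ∧
      (m : ℝ) ^ 2 * ((ℓ : ℝ) / n) ^ (k - 1) / n = ℓ * L ^ 2 := by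
  have hn' : (0 : ℝ) < n := by exact_mod_cast hn
  have hm' : (0 : ℝ) < m := by exact_mod_cast hm
  have hℓ' : (0 : ℝ) < ℓ := by exact_mod_cast hℓ
  set r := (ℓ : ℝ) / n with hr
  have hr0 : 0 < r := by positivity
  have hr1 : r ≤ 1 := by rw [hr, div_le_one hn']; exact_mod_cast hℓn
  have hinv : (n : ℝ) / ℓ = r⁻¹ := by rw [hr, inv_div]
  have hk2 : (0 : ℝ) ≤ (k : ℝ) / 2 - 1 := by
    have : (2 : ℝ) ≤ k := by exact_mod_cast hk
    linarith
  set W := (2 : ℝ) ^ (a * (k : ℝ)) with hW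
  have hW0 : 0 < W := Real.rpow_pos_of_pos two_pos _
  set g := r ^ ((k : ℝ) / 2 - 1) with hg
  have hg0 : 0 < g := Real.rpow_pos_of_pos hr0 _
  have hg1 : g ≤ 1 := Real.rpow_le_one hr0.le hr1 hk2
  have hgi : (r⁻¹) ^ ((k : ℝ) / 2 - 1) = g⁻¹ := Real.inv_rpow hr0.le _
  rw [hinv, hgi] at h
  have hd4 : (0 : ℝ) < δ ^ 4 := by positivity
  have key : W * Real.log n * n ≤ m * g * δ ^ 4 := by
    have : W / δ ^ 4 * g⁻¹ * (n * Real.log n) = (W * Real.log n * n) / (g * δ ^ 4) := by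
      field_simp
    rw [this, ge_iff_le, div_le_iff₀ (by positivity)] at h
    linarith
  have pw : ∀ j : ℕ, (k : ℝ) / 2 - 1 ≤ j → r ^ j ≤ g := by
    intro j hj
    rw [← Real.rpow_natCast, hg]
    exact Real.rpow_le_rpow_of_exponent_ge hr0 hr1 hj
  refine ⟨m / n * g, by positivity, ?_, ?_, ?_, ?_, ?_⟩
  · have : m / n * g * δ ^ 4 = (m * g * δ ^ 4) / n := by ring
    rw [this, le_div_iff₀ hn']; exact key
  · refine key.trans ?_
    have : (m : ℝ) * g ≤ m := mul_le_of_le_one_right hm'.le hg1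
    gcongr
  · have := pw (k / 2) (by
      have : k ≤ 2 * (k / 2) + 1 := by omega
      have : (k : ℝ) ≤ 2 * (k / 2 : ℕ) + 1 := by exact_mod_cast this
      linarith)
    calc m * (r ^ (k / 2) / n) ≤ m * (g / n) := by gcongr
      _ = _ := by ring
  · have := pw (k - 1 - k / 2) (by
      have : k ≤ 2 * (k - 1 - k / 2) + 2 := by omega
      have : (k : ℝ) ≤ 2 * (k - 1 - k / 2 : ℕ) + 2 := by exact_mod_cast this
      linarith)
    calc m * (r ^ (k - 1 - k / 2) / n) ≤ m * (g / n) := by gcongr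
      _ = _ := by ring
  · have e1 : g ^ 2 = r ^ (k - 2) := by
      rw [hg, ← Real.rpow_natCast, ← Real.rpow_mul hr0.le, ← Real.rpow_natCast]
      congr 1
      push_cast [Nat.cast_sub hk]; ring
    have e2 : r ^ (k - 1) = r * r ^ (k - 2) := by
      rw [← pow_succ']; congr 1; omega
    have e3 : (ℓ : ℝ) = r * n := by rw [hr]; field_simp
    rw [mul_pow, e1, e2, e3]
    field_simp

theorem hx_trace_root (q ℓ : ℕ) (n N T D : ℝ) (hn : 1 ≤ n) (hℓ : 1 ≤ ℓ)
    (hN : 0 ≤ N) (hNn : N ≤ n ^ ℓ) (hD : 0 ≤ D)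
    (hP : (ℓ : ℝ) * Real.log n ≤ ((2 ^ (q + 1) : ℕ) : ℝ))
    (h : T ^ (2 ^ (q + 1)) ≤ N ^ (2 ^ (q + 1)) * (n * (N * D ^ (2 ^ (q + 1))))) :
    |T| ≤ 8 * (N * D) := by
  set P := 2 ^ (q + 1) with hPdef
  have hP0 : P ≠ 0 := by positivity
  have hn0 : 0 < n := by linarith
  have e1 : n * N ≤ 8 ^ P := by
    calc n * N ≤ n * n ^ ℓ := by gcongr
      _ = Real.exp ((ℓ + 1) * Real.log n) := by
        have : ((ℓ : ℝ) + 1) * Real.log n = ((ℓ + 1 : ℕ) : ℝ) * Real.log n := by push_cast; ring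
        rw [this, Real.exp_nat_mul, Real.exp_log hn0]; ring
      _ ≤ Real.exp (P * 2) := by
        refine Real.exp_le_exp.2 ?_
        have h1 : (1 : ℝ) ≤ ℓ := by exact_mod_cast hℓ
        have h2 := Real.log_nonneg hn
        nlinarith
      _ = (Real.exp 2) ^ P := Real.exp_nat_mul _ _
      _ ≤ 8 ^ P := by
        have h1 := Real.exp_one_lt_d9
        have h2 : Real.exp 2 = Real.exp 1 * Real.exp 1 := by rw [← Real.exp_add]; norm_num
        have h3 := Real.exp_pos 1
        gcongr
        rw [h2]; nlinarith
  have e2 : |T| ^ P ≤ (8 * (N * D)) ^ P := by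
    have hev : Even P := by rw [hPdef, pow_succ']; exact even_two_mul _
    rw [hev.pow_abs]
    calc T ^ P ≤ _ := h
      _ = (n * N) * (N * D) ^ P := by rw [mul_pow]; ring
      _ ≤ 8 ^ P * (N * D) ^ P := by gcongr
      _ = _ := by rw [← mul_pow]
  exact le_of_pow_le_pow_left₀ hP0 (by positivity) e2

theorem hx_num_final (n m z δ lam ε : ℝ) (hz : 4 ≤ z) (hδ : 0 < δ) (hδ1 : δ < 1 / 2)
    (hm : 0 < m)
    (h1 : n * z ^ 40 ≤ m * δ ^ 4)
    (h2 : lam ≤ 6 * δ ^ 2 / z ^ 20) (h3 : n ^ 2 * ε ≤ δ ^ 4 / z ^ 40) :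
    n / m + z ^ 4 * (56 * lam + 2 * (n ^ 2 * ε)) ≤ δ ^ 2 := by
  have hz0 : 0 < z := by linarith
  have hd2 : δ ^ 2 ≤ 1 / 4 := by nlinarith
  have hd20 : 0 < δ ^ 2 := by positivity
  have hd4 : δ ^ 4 ≤ δ ^ 2 / 4 := by nlinarith
  have z16 : (4 : ℝ) ^ 16 ≤ z ^ 16 := by gcongr
  have z36 : (4 : ℝ) ^ 36 ≤ z ^ 36 := by gcongr
  have z40 : (4 : ℝ) ^ 40 ≤ z ^ 40 := by gcongr
  have a1 : n / m ≤ δ ^ 2 / 4 := by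
    rw [div_le_iff₀ hm]
    have : n ≤ m * δ ^ 4 := by
      by_cases hn : 0 ≤ n
      · nlinarith
      · have : 0 < m * δ ^ 4 := by positivity
        linarith
    nlinarith
  have a2 : z ^ 4 * (56 * lam) ≤ δ ^ 2 / 4 := by
    calc z ^ 4 * (56 * lam) ≤ z ^ 4 * (56 * (6 * δ ^ 2 / z ^ 20)) := by gcongr
      _ = 336 * δ ^ 2 / z ^ 16 := by field_simp; norm_num
      _ ≤ _ := by
        rw [div_le_iff₀ (by positivity)]; nlinarith
  have a3 : z ^ 4 * (2 * (n ^ 2 * ε)) ≤ δ ^ 2 / 4 := by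
    calc z ^ 4 * (2 * (n ^ 2 * ε)) ≤ z ^ 4 * (2 * (δ ^ 4 / z ^ 40)) := by gcongr
      _ = 2 * δ ^ 4 / z ^ 36 := by field_simp
      _ ≤ _ := by
        rw [div_le_iff₀ (by positivity)]; nlinarith
  nlinarith

/-- Deterministic conclusion. -/
theorem hx_good_concl {k n m ℓ : ℕ} [NeZero k] (hk : 2 ≤ k) (hn : 0 < n) (hm : 0 < m)
    (hkℓ : 2 * k ≤ ℓ) (s s' b t q : ℕ)
    (hs : s = b + (hxJ1 k).card) (hs' : s' = b + (hxJ2 k).card) (hsl : s + s' ≤ ℓ)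
    (H : Fin m → Fin k → Fin n) (τ : Fin m → Bool)
    (δ lam Δ ε : ℝ) (hδ : 0 < δ) (hδ1 : δ < 1 / 2) (hlam0 : 0 ≤ lam) (hΔ : 0 ≤ Δ)
    (hE2 : (0 : ℝ) < ((n - ((hxJ1 k).card + (hxJ2 k).card)).choose b : ℝ))
    (hN : n * ((Fintype.card (HxX n s s') : ℝ) * Δ) ≤ (m : ℝ) ^ 2 * ((2 ^ k) ^ 4 *
      ((n - ((hxJ1 k).card + (hxJ2 k).card)).choose b : ℝ) ^ 2))
    (hNn : (Fintype.card (HxX n s s') : ℝ) ≤ (n : ℝ) ^ ℓ)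
    (hP : (ℓ : ℝ) * Real.log n ≤ ((2 ^ (q + 1) : ℕ) : ℝ))
    (hlam : lam ≤ 6 * δ ^ 2 / (2 ^ k) ^ 20) (hε0 : 0 ≤ ε)
    (hε : (n : ℝ) ^ 2 * ε ≤ δ ^ 4 / (2 ^ k) ^ 40)
    (hmn : n * (2 ^ k) ^ 40 ≤ m * δ ^ 4)
    (g1 : ∑ i, hxInd (¬ hxInj (H i)) ≤ (2 * (k : ℝ) ^ 2 / n) * m)
    (g2 : (((hxK k n s s').A t H τ) ^ (2 ^ (q + 1))).trace ≤
      n * ((Fintype.card (HxX n s s') : ℝ) * (7 * Δ * lam) ^ (2 ^ (q + 1))))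
    (g3 : hxBad s s' t H ≤ n * ((Fintype.card (HxX n s s') : ℝ) * Δ * (n * ε)))
    (d : ℕ) (hd : 2 * ℓ ≤ d) (E : PseudoExpectation n d) :
    |E.toFun (MvPolynomial.C ((m : ℝ)⁻¹) *
              ∑ i : Fin m, MvPolynomial.C (if τ i then (1 : ℝ) else -1) *
                ∏ j : Fin k, X (H i j))| ≤ δ + 2 * (k : ℝ) ^ 2 / n := by
  have hm' : (0 : ℝ) < m := by exact_mod_cast hm
  have hn' : (0 : ℝ) < n := by exact_mod_cast hn
  refine hx_final_det hm E (by omega) H τ δ _ ?_ g1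
  have D := hx_det hk hn E s s' b t hs hs' (by omega) (by omega) H τ
  set Y := ∑ i, (hxSg (τ i) * hxInd (hxInj (H i))) * E.toFun (X (H i 0) * hxY (H i)) with hY
  set N := (Fintype.card (HxX n s s') : ℝ) with hNdef
  set E0 := ((n - ((hxJ1 k).card + (hxJ2 k).card)).choose b : ℝ) with hE0
  have hNn0 : 0 ≤ N := by positivity
  have T := hx_power (hxM E s s') ((hxK k n s s').A t H τ) (hxM_psd E s s' (by omega))
    (hxM_diag E s s' (by omega)) (hxA_symm s s' t H τ) q
  have T2 : |((hxK k n s s').A t H τ * hxM E s s').trace| ≤ 8 * (N * (7 * Δ * lam)) := by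
    refine hx_trace_root q ℓ n N _ (7 * Δ * lam) (by exact_mod_cast hn) (by omega) hNn0 hNn
      (by positivity) hP (T.trans ?_)
    gcongr
  have hz : (4 : ℝ) ≤ 2 ^ k := by
    calc (4 : ℝ) = 2 ^ 2 := by norm_num
      _ ≤ 2 ^ k := by gcongr; norm_num
  have F := hx_num_final n m (2 ^ k) δ lam ε hz hδ hδ1 hm' hmn hlam hε
  have main : E0 ^ 2 * Y ^ 2 ≤ E0 ^ 2 * (δ * m) ^ 2 := by
    calc E0 ^ 2 * Y ^ 2 ≤ _ := D
      _ ≤ n * (E0 ^ 2 * m + 8 * (N * (7 * Δ * lam)) + 2 * (n * (N * Δ * (n * ε)))) := by gcongr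
      _ = n * (E0 ^ 2 * m) + (n * (N * Δ)) * (56 * lam + 2 * (n ^ 2 * ε)) := by ring
      _ ≤ n * (E0 ^ 2 * m) + ((m : ℝ) ^ 2 * ((2 ^ k) ^ 4 * E0 ^ 2)) *
          (56 * lam + 2 * (n ^ 2 * ε)) := by gcongr
      _ = E0 ^ 2 * (m ^ 2 * (n / m + (2 ^ k) ^ 4 * (56 * lam + 2 * (n ^ 2 * ε)))) := by
          field_simp
      _ ≤ E0 ^ 2 * (m ^ 2 * δ ^ 2) := by gcongr
      _ = _ := by ring
  have : Y ^ 2 ≤ (δ * m) ^ 2 := le_of_mul_le_mul_left main (by positivity)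
  exact abs_le_of_sq_le_sq this (by positivity)

theorem hx_union {A B : Type*} [Fintype A] [Fintype B] (Q1 Q3 : A → Prop) (Q2 : A × B → Prop)
    (c : ℝ) (h1 : ∑ a, hxInd (Q1 a) ≤ c * (Fintype.card A : ℝ))
    (h2 : ∑ p, hxInd (Q2 p) ≤ c * (Fintype.card (A × B) : ℝ))
    (h3 : ∑ a, hxInd (Q3 a) ≤ c * (Fintype.card A : ℝ)) :
    (1 - 3 * c) * (Fintype.card (A × B) : ℝ) ≤
      ∑ p : A × B, hxInd (¬ Q1 p.1 ∧ ¬ Q2 p ∧ ¬ Q3 p.1) := by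
  have pt : ∀ p : A × B, 1 - hxInd (Q1 p.1) - hxInd (Q2 p) - hxInd (Q3 p.1) ≤
      hxInd (¬ Q1 p.1 ∧ ¬ Q2 p ∧ ¬ Q3 p.1) := by
    intro p
    by_cases a1 : Q1 p.1 <;> by_cases a2 : Q2 p <;> by_cases a3 : Q3 p.1 <;>
      simp [hxInd, a1, a2, a3]
  have s := Finset.sum_le_sum fun p (_ : p ∈ (univ : Finset (A × B))) => pt p
  refine le_trans ?_ s
  simp only [Finset.sum_sub_distrib]
  have f : ∀ Q : A → Prop, ∑ a, hxInd (Q a) ≤ c * (Fintype.card A : ℝ) →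
      ∑ p : A × B, hxInd (Q p.1) ≤ c * (Fintype.card (A × B) : ℝ) := by
    intro Q hQ
    rw [Fintype.sum_prod_type]
    simp only [Finset.sum_const, Finset.card_univ, nsmul_eq_mul, Fintype.card_prod]
    rw [← Finset.mul_sum]
    push_cast
    have : (0 : ℝ) ≤ Fintype.card B := by positivity
    nlinarith
  have f1 := f Q1 h1
  have f3 := f Q3 h3
  have : ∑ p : A × B, (1 : ℝ) = (Fintype.card (A × B) : ℝ) := by simp
  rw [this]
  linarith

/-- Few non-injective tuples. -/
theorem hx_few (k n m : ℕ) (hk : 2 ≤ k) (hn : 0 < n) (hlog : n * Real.log n ≤ m) :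
    ∑ H : Fin m → Fin k → Fin n,
      hxInd ((2 * (k : ℝ) ^ 2 / n) * m < ∑ i, hxInd (¬ hxInj (H i))) ≤
    (1 / n) * (Fintype.card (Fin m → Fin k → Fin n) : ℝ) := by
  classical
  have hn' : (0 : ℝ) < n := by exact_mod_cast hn
  have : Nonempty (Fin k → Fin n) := ⟨fun _ => ⟨0, hn⟩⟩
  set μ : ℝ := m * ((k : ℝ) ^ 2 / (2 * n)) with hμ
  have hμ0 : 0 ≤ μ := by positivity
  have hμl : Real.log n ≤ μ := by
    have hk2 : (2 : ℝ) ≤ k := by exact_mod_cast hk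
    have : (m : ℝ) / n ≤ μ := by
      rw [hμ, div_le_iff₀ hn']
      have : (m : ℝ) * ((k : ℝ) ^ 2 / (2 * n)) * n = m * ((k : ℝ) ^ 2 / 2) := by field_simp
      rw [this]
      have : (1 : ℝ) ≤ (k : ℝ) ^ 2 / 2 := by nlinarith
      nlinarith [(Nat.cast_nonneg m : (0 : ℝ) ≤ m)]
    refine le_trans ?_ this
    rw [le_div_iff₀ hn']; linarith
  set q := ⌈4 * μ⌉₊ with hq
  have hq4 : 4 * μ ≤ q := Nat.le_ceil _
  have T := hx_tail (m := m) (β := Fin k → Fin n) univ (fun _ => 1) (fun C => ¬ hxInj C)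
    ((k : ℝ) ^ 2 / (2 * n)) (by positivity) (fun _ => zero_le_one) (fun _ _ _ _ => rfl)
    (hx_collide k n hn) q
  simp only [one_mul] at T
  have hc : ∑ H : Fin m → Fin k → Fin n, (1 : ℝ) =
    (Fintype.card (Fin m → Fin k → Fin n) : ℝ) := by simp
  rw [hc] at T
  refine le_trans (Finset.sum_le_sum fun H _ => hxInd_mono ?_) (T.trans ?_)
  · intro h
    rw [hx_sum_ind] at h
    have h1 : 4 * μ ≤ ((univ.filter fun i => ¬ hxInj (H i)).card : ℝ) := by
      refine le_of_eq_of_le ?_ h.le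
      rw [hμ]; field_simp; ring
    have h2 : q ≤ (univ.filter fun i => ¬ hxInj (H i)).card := Nat.ceil_le.2 h1
    obtain ⟨I, hI, hIc⟩ := Finset.exists_subset_card_eq h2
    exact ⟨I, Finset.subset_univ _, hIc, fun l hl => (Finset.mem_filter.1 (hI hl)).2⟩
  · refine mul_le_mul_of_nonneg_right ?_ (by positivity)
    refine (hx_poisson μ hμ0 q).trans ?_
    calc Real.exp (2.7182818286 * μ - q) ≤ Real.exp (-Real.log n) :=
          Real.exp_le_exp.2 (by linarith)
      _ = _ := by rw [Real.exp_neg, Real.exp_log hn', one_div]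

set_option maxHeartbeats 4000000 in
theorem hx_main (n m k ℓ : ℕ) (hn : 0 < n) (hm : 0 < m) (hℓ : 0 < ℓ) (hk : 2 ≤ k)
    (δ : ℝ) (hδ : 0 < δ) (hδ1 : δ < 1 / 2) (hkℓ : 2 * k ≤ ℓ) (hℓn : (ℓ : ℝ) ≤ (n : ℝ) / 8)
    (hyp : (m : ℝ) ≥ (2 : ℝ) ^ ((40 : ℝ) * (k : ℝ)) / δ ^ 4 *
        ((n : ℝ) / (ℓ : ℝ)) ^ ((k : ℝ) / 2 - 1) * ((n : ℝ) * Real.log n)) :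
    (1 - 3 * (1 / (n : ℝ))) * (Fintype.card ((Fin m → Fin k → Fin n) × (Fin m → Bool)) : ℝ) ≤
    ∑ p : (Fin m → Fin k → Fin n) × (Fin m → Bool), hxInd (
        ∀ d : ℕ, 2 * ℓ ≤ d → ∀ E : PseudoExpectation n d,
          |E.toFun (MvPolynomial.C ((m : ℝ)⁻¹) *
              ∑ i : Fin m, MvPolynomial.C (if p.2 i then (1 : ℝ) else -1) *
                ∏ j : Fin k, X (p.1 i j))| ≤
            δ + 2 * (k : ℝ) ^ 2 / (n : ℝ)) := by
  classical
  have : NeZero k := ⟨by omega⟩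
  have hn' : (0 : ℝ) < n := by exact_mod_cast hn
  have hm' : (0 : ℝ) < m := by exact_mod_cast hm
  have hℓ' : (0 : ℝ) < ℓ := by exact_mod_cast hℓ
  have h8 : 8 * ℓ ≤ n := by
    have : (8 : ℝ) * ℓ ≤ n := by linarith
    exact_mod_cast this
  have n32 : (32 : ℝ) ≤ n := by
    have : 32 ≤ n := by omega
    exact_mod_cast this
  have hlog : 1 ≤ Real.log n := by
    rw [Real.le_log_iff_exp_le hn']
    have := Real.exp_one_lt_d9
    linarith
  obtain ⟨L, hL0, hL1, hL2, hL3, hL4, hL5⟩ :=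
    hx_L_props n m k ℓ 40 δ hn hm hℓ hk hδ (by omega) hlog hyp
  have hW : (2 : ℝ) ^ ((40 : ℝ) * (k : ℝ)) = (2 ^ k) ^ 40 := by
    rw [← pow_mul, ← Real.rpow_natCast]; congr 1; push_cast; ring
  rw [hW] at hL1 hL2
  set z : ℝ := 2 ^ k with hzdef
  have hz : (4 : ℝ) ≤ z := by
    calc (4 : ℝ) = 2 ^ 2 := by norm_num
      _ ≤ 2 ^ k := by gcongr; norm_num
  have hz40 : (1 : ℝ) ≤ z ^ 40 := one_le_pow₀ (by linarith)
  have hz40' : (34 : ℝ) ≤ z ^ 40 := by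
    calc (34 : ℝ) ≤ 4 ^ 40 := by norm_num
      _ ≤ z ^ 40 := by gcongr
  have hd4 : δ ^ 4 ≤ 1 := pow_le_one₀ hδ.le (by linarith)
  have hd40 : 0 < δ ^ 4 := by positivity
  have hLz : z ^ 40 ≤ L * δ ^ 4 :=
    le_trans (le_mul_of_one_le_right (by positivity) hlog) hL1
  have hLlog : Real.log n ≤ L :=
    le_trans (le_mul_of_one_le_left (by linarith) hz40)
      (hL1.trans (mul_le_of_le_one_right hL0.le hd4))
  have hL1' : 1 ≤ L := by linarith
  -- sizes
  set b := (ℓ - k + 1) / 2 with hb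
  set a1 := (hxJ1 k).card with ha1
  set a2 := (hxJ2 k).card with ha2
  have ha1k : a1 = k / 2 := hxJ1_card k hk
  have ha2k : a2 = k - 1 - k / 2 := hxJ2_card k hk
  have ha12 : a1 + a2 = k - 1 := by omega
  set s := b + a1 with hs
  set s' := b + a2 with hs'
  have hss : s + s' ≤ ℓ := by omega
  set r := (ℓ : ℝ) / n with hr
  have hr0 : 0 ≤ r := by positivity
  have hrn : r * n = ℓ := by rw [hr]; field_simp
  have hsr : (s : ℝ) ≤ r * n := by
    rw [hrn]; have : s ≤ ℓ := by omega
    exact_mod_cast this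
  have hsr' : (s' : ℝ) ≤ r * n := by
    rw [hrn]; have : s' ≤ ℓ := by omega
    exact_mod_cast this
  -- constants
  set c1 := r ^ a1 with hc1
  set d1 := r ^ a1 / n with hd1
  set c2 := r ^ a2 / n with hc2
  have hc10 : 0 ≤ c1 := by positivity
  have hd10 : 0 ≤ d1 := by positivity
  have hc20 : 0 ≤ c2 := by positivity
  have hmc2 : m * c2 ≤ L := by rw [hc2, ha2k]; exact hL4
  have hmd1 : m * d1 ≤ L := by rw [hd1, ha1k]; exact hL3
  set Δ : ℝ := ℓ * L ^ 2 with hΔ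
  have hΔ0 : 0 < Δ := by positivity
  have hΔe : (m : ℝ) ^ 2 * (c1 * c2) = Δ := by
    rw [← hL5, ← ha12, hc1, hc2, pow_add]; ring
  set N := (Fintype.card (HxX n s s') : ℝ) with hN
  have hN0 : 0 ≤ N := by positivity
  -- parameters
  set t := ⌈16 * L⌉₊ with ht
  have ht1 : 16 * L ≤ t := Nat.le_ceil _
  have ht2 : (t : ℝ) ≤ 17 * L := by
    have := Nat.ceil_lt_add_one (a := 16 * L) (by positivity)
    linarith
  have ht0 : 1 ≤ t := by
    have : (1 : ℝ) ≤ t := by linarith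
    exact_mod_cast this
  have hx1 : 1 ≤ (ℓ : ℝ) * Real.log n := by
    have : (1 : ℝ) ≤ ℓ := by exact_mod_cast hℓ
    nlinarith
  obtain ⟨q0, hq0a, hq0b⟩ := exists_nat_pow_near hx1 (one_lt_two)
  set P : ℕ := 2 ^ (q0 + 1) with hP
  have hP1 : (ℓ : ℝ) * Real.log n ≤ (P : ℝ) := by rw [hP]; push_cast; exact hq0b.le
  have hP2 : (P : ℝ) ≤ 2 * (ℓ * Real.log n) := by
    rw [hP]; push_cast; rw [pow_succ]; linarith
  have hP0 : (0 : ℝ) < P := by rw [hP]; positivity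
  have ht0' : (0 : ℝ) < t := by exact_mod_cast ht0
  set lam := Real.sqrt (P * t / Δ) with hlam
  have hlam0 : 0 < lam := Real.sqrt_pos.2 (by positivity)
  have hlam2 : lam ^ 2 = P * t / Δ := Real.sq_sqrt (by positivity)
  have hlam2' : Δ * lam ^ 2 = P * t := by rw [hlam2]; field_simp
  have hlamb : lam ≤ 6 * δ ^ 2 / z ^ 20 := by
    have h1 : lam ^ 2 ≤ (6 * δ ^ 2 / z ^ 20) ^ 2 := by
      rw [hlam2]
      calc (P : ℝ) * t / Δ ≤ (2 * (ℓ * Real.log n)) * (17 * L) / Δ := by gcongr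
        _ = 34 * Real.log n / L := by rw [hΔ]; field_simp; norm_num
        _ ≤ 34 * (δ ^ 4 / z ^ 40) := by
          rw [div_le_iff₀ hL0]
          have : Real.log n ≤ δ ^ 4 / z ^ 40 * L := by
            rw [div_mul_eq_mul_div, le_div_iff₀ (by positivity)]; linarith
          linarith
        _ ≤ 36 * (δ ^ 4 / z ^ 40) := by gcongr; norm_num
        _ = _ := by rw [div_pow]; ring
    exact (pow_le_pow_iff_left₀ hlam0.le (by positivity) two_ne_zero).1 h1
  have hlam1 : lam ≤ 1 := by
    refine hlamb.trans ?_
    have : (4 : ℝ) ^ 20 ≤ z ^ 20 := by gcongr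
    rw [div_le_one (by positivity)]
    have h6 : δ ^ 2 ≤ 1 := pow_le_one₀ hδ.le (by linarith)
    calc 6 * δ ^ 2 ≤ (4 : ℝ) ^ 20 := by norm_num; linarith
      _ ≤ _ := this
  set ε := Real.exp (-(12 * L)) with hε
  have hεb : (n : ℝ) ^ 2 * ε ≤ δ ^ 4 / z ^ 40 := by
    have h1 : ε ≤ Real.exp (-(2 * Real.log n)) * Real.exp (-L) := by
      rw [hε, ← Real.exp_add]; exact Real.exp_le_exp.2 (by linarith)
    have h2 : Real.exp (-(2 * Real.log n)) = ((n : ℝ) ^ 2)⁻¹ := by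
      rw [Real.exp_neg]
      congr 1
      have := Real.exp_nat_mul (Real.log n) 2
      rw [Real.exp_log hn'] at this
      exact_mod_cast this
    have h3 : Real.exp (-L) ≤ 1 / L := by
      rw [Real.exp_neg, one_div]
      have := Real.add_one_le_exp L
      gcongr
      linarith
    calc (n : ℝ) ^ 2 * ε ≤ n ^ 2 * (((n : ℝ) ^ 2)⁻¹ * (1 / L)) := by
          rw [h2] at h1
          gcongr
          exact h1.trans (by gcongr)
      _ = 1 / L := by field_simp
      _ ≤ _ := by
        rw [div_le_div_iff₀ hL0 (by positivity)]; linarith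
  have hqb : (m * c2) ^ (t - 1) / ((t - 1).factorial : ℝ) ≤ ε := by
    calc (m * c2) ^ (t - 1) / ((t - 1).factorial : ℝ) ≤ L ^ (t - 1) / ((t - 1).factorial : ℝ) := by
          gcongr
      _ ≤ _ := hx_poisson L hL0.le (t - 1)
      _ ≤ ε := by
        rw [hε]
        refine Real.exp_le_exp.2 ?_
        rw [Nat.cast_sub ht0]; push_cast
        linarith
  have hβ : Nonempty (Fin k → Fin n) := ⟨fun _ => ⟨0, hn⟩⟩
  -- moments
  have MM := (hxK k n s s').moment (m := m) t c1 c2 d1 lam (7 * (P * t)) hc10 hc20 hd10 hlam0 hlam1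
    (hxK_H1 k n s s' r hsr) (hxK_H1' k n s s' r hn hsr) (hxK_H2 k n s s' r hn hsr')
    (hxK_Hs k n s s') P (by
      have e1 : lam ^ 2 * (m : ℝ) ^ 2 * (c1 * c2) = P * t := by
        rw [mul_assoc, hΔe, ← hlam2']; ring
      rw [e1]
      have hLt : L ≤ t := by linarith
      have e2 : lam * (2 * P) * (m * c2) ≤ 1 * (2 * P) * t := by
        gcongr
        exact hmc2.trans hLt
      have e3 : lam * (2 * P) * (m * d1) ≤ 1 * (2 * P) * t := by
        gcongr
        exact hmd1.trans hLt
      linarith)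
  have eF : 7 * ((P : ℝ) * t) / lam = 7 * Δ * lam := by
    rw [← hlam2']; field_simp
  rw [eF] at MM
  have hnlog : 0 ≤ (n : ℝ) * Real.log n := by positivity
  have hzn : z ^ 40 * (n * Real.log n) ≤ m * δ ^ 4 := by linarith
  have hnm : (n : ℝ) * Real.log n ≤ m :=
    le_trans (le_mul_of_one_le_left hnlog hz40)
      (hzn.trans (mul_le_of_le_one_right hm'.le hd4))
  -- the three events
  have S1 := hx_few k n m hk hn hnm
  have BE := (hxK k n s s').bad_edges (m := m) (t := t) (q := t - 1) (by omega) c1 c2 hc10 hc20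
    (hxK_H1 k n s s' r hsr) (hxK_H2 k n s s' r hn hsr') (hxK_Hs k n s s')
  have S3 := hx_markov (fun H : Fin m → Fin k → Fin n => hxBad s s' t H)
    (fun H => Finset.sum_nonneg fun _ _ => Finset.sum_nonneg fun _ _ => Finset.sum_nonneg
      fun _ _ => hxInd_nonneg _) (N * Δ * (n * ε)) n (by positivity) hn' (by
      refine BE.trans ?_
      rw [hΔe]
      simp only [Fintype.card_fin, Fintype.card_fun, Nat.cast_pow, ← hN]
      gcongr)
  have S2 := hx_markov (fun p : (Fin m → Fin k → Fin n) × (Fin m → Bool) =>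
      (((hxK k n s s').A t p.1 p.2) ^ P).trace)
    (fun p => by
      have e : P = 2 ^ q0 * 2 := by rw [hP, pow_succ]
      rw [e, pow_mul, hx_trsq]
      · exact Finset.sum_nonneg fun _ _ => Finset.sum_nonneg fun _ _ => sq_nonneg _
      · rw [Matrix.transpose_pow, hxA_symm])
    (N * (7 * Δ * lam) ^ P) n (by positivity) hn' (by
      rw [Fintype.sum_prod_type]
      refine MM.trans (le_of_eq ?_)
      rw [← hN]
      simp only [Fintype.card_prod, Fintype.card_fun, Fintype.card_fin, Fintype.card_bool]
      push_cast
      ring)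
  have U := hx_union _ _ _ (1 / (n : ℝ)) S1 S2 S3
  refine U.trans (Finset.sum_le_sum fun p _ => hxInd_mono ?_)
  rintro ⟨g1, g2, g3⟩
  rw [not_lt] at g1 g2 g3
  have hch := hx_card_bound n k ℓ b a1 a2 hn (by omega) (by omega) (by omega)
  refine hx_good_concl hk hn hm hkℓ s s' b t q0 hs hs' hss p.1 p.2 δ lam Δ ε hδ hδ1 hlam0.le
    hΔ0.le ?_ ?_ ?_ hP1 hlamb (Real.exp_pos _).le hεb ?_ g1 g2 g3
  · exact_mod_cast Nat.choose_pos (by omega)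
  · rw [← hN, ← hL5, ← ha12]
    have z4 : (16 : ℝ) ^ k = z ^ 4 := by
      rw [hzdef, ← pow_mul, mul_comm, pow_mul]; norm_num
    rw [z4] at hch
    calc n * (N * ((m : ℝ) ^ 2 * r ^ (a1 + a2) / n)) = (m : ℝ) ^ 2 * (N * r ^ (a1 + a2)) := by
          field_simp
      _ ≤ _ := by gcongr
  · rw [hx_card_X]
    push_cast
    have e1 : (n.choose s : ℝ) ≤ (n : ℝ) ^ s := by exact_mod_cast Nat.choose_le_pow n s
    have e2 : (n.choose s' : ℝ) ≤ (n : ℝ) ^ s' := by exact_mod_cast Nat.choose_le_pow n s'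
    calc (n.choose s : ℝ) * n.choose s' ≤ (n : ℝ) ^ s * (n : ℝ) ^ s' := by gcongr
      _ = (n : ℝ) ^ (s + s') := (pow_add _ _ _).symm
      _ ≤ _ := pow_le_pow_right₀ (by linarith) hss
  · refine le_trans ?_ hzn
    rw [mul_comm]
    exact mul_le_mul_of_nonneg_left (le_mul_of_one_le_right hn'.le hlog) (by positivity)

/-- SoS refutation of random `k`-XOR, over a hypergraph whose hyperedges are uniform in
`[n]^k`. The sample point `ω : Fin m → ((Fin k → Fin n) × Bool)` encodes, for each of the
`m` constraints, a uniform tuple `C ∈ [n]^k` together with a Rademacher sign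
`σ_C = ±1` (`true ↦ 1`, `false ↦ −1`); all coordinates are uniform and independent.
An `ω` is good if every pseudo-expectation `Ẽ` of degree `≥ 2ℓ` satisfies
`|Ẽ[(1/m) Σ_{C∈H} σ_C x_C]| ≤ δ + 2k²/n`. The claim: for suitable absolute constants
`a, c > 0`, under the stated conditions at least a `1 − n^{−c}` fraction of all `ω`
are good. -/
theorem stmt14 :
    ∃ a c : ℝ, 0 < a ∧ 0 < c ∧
    ∀ (n m k ℓ : ℕ), 0 < n → 0 < m → 0 < ℓ → 2 ≤ k →
    ∀ δ : ℝ, 0 < δ → δ < 1 / 2 →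
    2 * k ≤ ℓ → (ℓ : ℝ) ≤ (n : ℝ) / 8 →
    (m : ℝ) ≥ (2 : ℝ) ^ (a * (k : ℝ)) / δ ^ 4 *
        ((n : ℝ) / (ℓ : ℝ)) ^ ((k : ℝ) / 2 - 1) * ((n : ℝ) * Real.log n) →
    ((Nat.card {ω : Fin m → ((Fin k → Fin n) × Bool) //
        ∀ d : ℕ, 2 * ℓ ≤ d → ∀ E : PseudoExpectation n d,
          |E.toFun (MvPolynomial.C ((m : ℝ)⁻¹) *
              ∑ i : Fin m, MvPolynomial.C (if (ω i).2 then (1 : ℝ) else -1) *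
                ∏ j : Fin k, X ((ω i).1 j))| ≤
            δ + 2 * (k : ℝ) ^ 2 / (n : ℝ)} : ℝ)) ≥
      (1 - (n : ℝ) ^ (-c)) * (Fintype.card (Fin m → ((Fin k → Fin n) × Bool)) : ℝ) := by
  classical
  refine ⟨40, 1 / 2, by norm_num, by norm_num, ?_⟩
  intro n m k ℓ hn hm hℓ hk δ hδ hδ1 hkℓ hℓn hyp
  have h := hx_main n m k ℓ hn hm hℓ hk δ hδ hδ1 hkℓ hℓn hyp
  have e := Equiv.arrowProdEquivProdArrow (Fin m) (fun _ => Fin k → Fin n) (fun _ => Bool)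
  rw [← Equiv.sum_comp (Equiv.arrowProdEquivProdArrow (Fin m) (fun _ => Fin k → Fin n)
    (fun _ => Bool)), ← Fintype.card_congr e, hx_sum_ind] at h
  rw [Nat.card_eq_fintype_card, Fintype.card_subtype, ge_iff_le]
  refine le_trans ?_ h
  refine mul_le_mul_of_nonneg_right ?_ (by positivity)
  have hn' : (0 : ℝ) < n := by exact_mod_cast hn
  have n9 : (9 : ℝ) ≤ n := by
    have : (4 : ℝ) ≤ ℓ := by
      have : 4 ≤ ℓ := by omega
      exact_mod_cast this
    linarith
  have h3 : 3 ≤ Real.sqrt n := by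
    rw [Real.le_sqrt (by norm_num) hn'.le]; linarith
  have e1 : (n : ℝ) ^ (-(1 / 2) : ℝ) = 1 / Real.sqrt n := by
    rw [Real.rpow_neg hn'.le, Real.sqrt_eq_rpow, one_div, one_div]
  rw [e1]
  have e2 : 3 * (1 / (n : ℝ)) ≤ 1 / Real.sqrt n := by
    rw [le_div_iff₀ (by positivity)]
    have := Real.mul_self_sqrt hn'.le
    rw [mul_one_div, div_mul_eq_mul_div, div_le_one hn']
    nlinarith
  linarith
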